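/- If Y = Y_pr (every point of Y lies on a principal closed orbit), then Y is G-reduced. In particular, a closed orbit Gv is G-reduced if and only if it is principal. -/

import Mathlib

/-!
Common framework: a "compact Lie group / complex reductive group acting on a
finite-dimensional module" is modelled as a subgroup of invertible `n × n`
matrices over `𝕜 = ℝ` or `ℂ` acting on `Fin n → 𝕜` by `Matrix.mulVec`.
Polynomial functions on the module are `MvPolynomial (Fin n) 𝕜`.
-/

set_option synthInstance.maxHeartbeats 1000000
set_option maxHeartbeats 1000000

noncomputable section

open MvPolynomial

namespace ZPaper

variable (𝕜 : Type) [RCLike 𝕜] (n : ℕ)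

/-- The zero set of a family of polynomials. -/
def zeroSet (S : Set (MvPolynomial (Fin n) 𝕜)) : Set (Fin n → 𝕜) :=
  {v | ∀ p ∈ S, eval v p = 0}

/-- A subset of `𝕜ⁿ` is algebraic if it is the zero set of a family of polynomials. -/
def IsAlgebraicSet (X : Set (Fin n → 𝕜)) : Prop :=
  ∃ S : Set (MvPolynomial (Fin n) 𝕜), X = zeroSet 𝕜 n S

/-- The vanishing ideal `I(X)` of a subset `X ⊆ 𝕜ⁿ`. -/
def vanishingIdeal (X : Set (Fin n → 𝕜)) : Ideal (MvPolynomial (Fin n) 𝕜) where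
  carrier := {p | ∀ x ∈ X, eval x p = 0}
  zero_mem' := by intro x _; simp
  add_mem' := by intro a b ha hb x hx; simp [ha x hx, hb x hx]
  smul_mem' := by intro c p hp x hx; simp [smul_eq_mul, hp x hx]

/-- The Zariski closure of a subset of `𝕜ⁿ`. -/
def zclosure (A : Set (Fin n → 𝕜)) : Set (Fin n → 𝕜) :=
  zeroSet 𝕜 n (vanishingIdeal 𝕜 n A : Set (MvPolynomial (Fin n) 𝕜))

/-- `A` is Zariski dense in `X`: every polynomial vanishing on `A` vanishes on `X`. -/
def ZDenseIn (A X : Set (Fin n → 𝕜)) : Prop :=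
  ∀ p : MvPolynomial (Fin n) 𝕜, (∀ a ∈ A, eval a p = 0) → ∀ x ∈ X, eval x p = 0

/-- A set of matrices is a subgroup of `GL_n(𝕜)`. -/
def IsMatSubgroup (G : Set (Matrix (Fin n) (Fin n) 𝕜)) : Prop :=
  (1 : Matrix (Fin n) (Fin n) 𝕜) ∈ G ∧ (∀ a ∈ G, ∀ b ∈ G, a * b ∈ G) ∧
    ∀ a ∈ G, IsUnit a ∧ a⁻¹ ∈ G

/-- `X` is a `G`-stable subset of `𝕜ⁿ`. -/
def Stabilizes (G : Set (Matrix (Fin n) (Fin n) 𝕜)) (X : Set (Fin n → 𝕜)) : Prop :=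
  ∀ g ∈ G, ∀ x ∈ X, Matrix.mulVec g x ∈ X

/-- A polynomial is `G`-invariant. -/
def Invariant (G : Set (Matrix (Fin n) (Fin n) 𝕜)) (p : MvPolynomial (Fin n) 𝕜) : Prop :=
  ∀ g ∈ G, ∀ v : Fin n → 𝕜, eval (Matrix.mulVec g v) p = eval v p

/-- `I_G(X)`: the ideal generated by the `G`-invariant polynomials vanishing on `X`,
i.e. by `I(X)^G = I(X) ∩ 𝕜[V]^G`. -/
def invariantIdeal (G : Set (Matrix (Fin n) (Fin n) 𝕜)) (X : Set (Fin n → 𝕜)) :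
    Ideal (MvPolynomial (Fin n) 𝕜) :=
  Ideal.span {p | Invariant 𝕜 n G p ∧ ∀ x ∈ X, eval x p = 0}

/-- `X` is `G`-reduced: `I_G(X) = I(X)`. -/
def IsGReduced (G : Set (Matrix (Fin n) (Fin n) 𝕜)) (X : Set (Fin n → 𝕜)) : Prop :=
  invariantIdeal 𝕜 n G X = vanishingIdeal 𝕜 n X

/-- `X` is almost `G`-reduced: `√I_G(X) = I(X)`. -/
def IsAlmostGReduced (G : Set (Matrix (Fin n) (Fin n) 𝕜)) (X : Set (Fin n → 𝕜)) : Prop :=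
  (invariantIdeal 𝕜 n G X).radical = vanishingIdeal 𝕜 n X

/-- The orbit `G·v`. -/
def orbit (G : Set (Matrix (Fin n) (Fin n) 𝕜)) (v : Fin n → 𝕜) : Set (Fin n → 𝕜) :=
  (fun g => Matrix.mulVec g v) '' G

/-- The isotropy group `G_v`. -/
def isotropy (G : Set (Matrix (Fin n) (Fin n) 𝕜)) (v : Fin n → 𝕜) :
    Set (Matrix (Fin n) (Fin n) 𝕜) :=
  {g ∈ G | Matrix.mulVec g v = v}

/-- Matrix exponential. -/
def mexp (A : Matrix (Fin n) (Fin n) 𝕜) : Matrix (Fin n) (Fin n) 𝕜 :=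
  ∑' k : ℕ, ((k.factorial : 𝕜)⁻¹) • A ^ k

/-- The Lie algebra of a matrix group: matrices whose one-parameter subgroup lies in `G`. -/
def lieAlgebra (G : Set (Matrix (Fin n) (Fin n) 𝕜)) : Set (Matrix (Fin n) (Fin n) 𝕜) :=
  {A | ∀ t : 𝕜, mexp 𝕜 n (t • A) ∈ G}

/-- The tangent space `T_v(G·v)` to the orbit, i.e. `𝔤·v`. -/
def orbitTangent (G : Set (Matrix (Fin n) (Fin n) 𝕜)) (v : Fin n → 𝕜) :
    Submodule 𝕜 (Fin n → 𝕜) :=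
  Submodule.span 𝕜 ((fun A => Matrix.mulVec A v) '' lieAlgebra 𝕜 n G)

/-- `N` is a `G_v`-stable complement to `T_v(G·v)` in `𝕜ⁿ` (a slice at `v`). -/
def IsSliceComplement (G : Set (Matrix (Fin n) (Fin n) 𝕜)) (v : Fin n → 𝕜)
    (N : Submodule 𝕜 (Fin n → 𝕜)) : Prop :=
  IsCompl (orbitTangent 𝕜 n G v) N ∧
    ∀ g ∈ isotropy 𝕜 n G v, ∀ x ∈ N, Matrix.mulVec g x ∈ N

/-- The image of `H` in `GL(N)` is trivial. -/
def ActsTriviallyOn (H : Set (Matrix (Fin n) (Fin n) 𝕜))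
    (N : Submodule 𝕜 (Fin n → 𝕜)) : Prop :=
  ∀ g ∈ H, ∀ x ∈ N, Matrix.mulVec g x = x

/-- The image of `H` in `GL(N)` is finite. -/
def HasFiniteImageOn (H : Set (Matrix (Fin n) (Fin n) 𝕜))
    (N : Submodule 𝕜 (Fin n → 𝕜)) : Prop :=
  Set.Finite ((fun g => fun x : N => Matrix.mulVec g (x : Fin n → 𝕜)) '' H)

/-- The orbit `G·v` is (Zariski) closed. -/
def HasClosedOrbit (G : Set (Matrix (Fin n) (Fin n) 𝕜)) (v : Fin n → 𝕜) : Prop :=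
  zclosure 𝕜 n (orbit 𝕜 n G v) ⊆ orbit 𝕜 n G v

/-- `v` lies on a principal orbit: `G·v` is closed and the isotropy group acts trivially on
some (hence any) slice at `v`. -/
def IsPrincipalPt (G : Set (Matrix (Fin n) (Fin n) 𝕜)) (v : Fin n → 𝕜) : Prop :=
  HasClosedOrbit 𝕜 n G v ∧
    ∃ N, IsSliceComplement 𝕜 n G v N ∧ ActsTriviallyOn 𝕜 n (isotropy 𝕜 n G v) N

/-- `v` lies on an almost principal orbit. -/
def IsAlmostPrincipalPt (G : Set (Matrix (Fin n) (Fin n) 𝕜)) (v : Fin n → 𝕜) : Prop :=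
  HasClosedOrbit 𝕜 n G v ∧
    ∃ N, IsSliceComplement 𝕜 n G v N ∧ HasFiniteImageOn 𝕜 n (isotropy 𝕜 n G v) N

/-- The set of principal points `V_pr`. -/
def prPoints (G : Set (Matrix (Fin n) (Fin n) 𝕜)) : Set (Fin n → 𝕜) :=
  {v | IsPrincipalPt 𝕜 n G v}

/-- The set of almost principal points `V_apr`. -/
def aprPoints (G : Set (Matrix (Fin n) (Fin n) 𝕜)) : Set (Fin n → 𝕜) :=
  {v | IsAlmostPrincipalPt 𝕜 n G v}

/-- `π⁻¹(π(Y))`: all points that the invariants cannot separate from `Y`. -/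
def saturation (G : Set (Matrix (Fin n) (Fin n) 𝕜)) (Y : Set (Fin n → 𝕜)) :
    Set (Fin n → 𝕜) :=
  {v | ∃ y ∈ Y, ∀ p, Invariant 𝕜 n G p → eval v p = eval y p}

/-- `Y` is `G`-saturated: `Y = π⁻¹(π(Y))`. -/
def IsSaturated (G : Set (Matrix (Fin n) (Fin n) 𝕜)) (Y : Set (Fin n → 𝕜)) : Prop :=
  Y = saturation 𝕜 n G Y

/-- The fiber `π⁻¹(π(v))` of the quotient morphism. -/
def piFiber (G : Set (Matrix (Fin n) (Fin n) 𝕜)) (v : Fin n → 𝕜) : Set (Fin n → 𝕜) :=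
  {u | ∀ p, Invariant 𝕜 n G p → eval u p = eval v p}

/-- The invariant ring `𝕜[V]^G` as a subalgebra of `𝕜[V]`. -/
def invariantSubalgebra (G : Set (Matrix (Fin n) (Fin n) 𝕜)) :
    Subalgebra 𝕜 (MvPolynomial (Fin n) 𝕜) where
  carrier := {p | Invariant 𝕜 n G p}
  mul_mem' := by intro a b ha hb g hg v; simp [ha g hg v, hb g hg v]
  one_mem' := by intro g hg v; simp
  add_mem' := by intro a b ha hb g hg v; simp [ha g hg v, hb g hg v]
  zero_mem' := by intro g hg v; simp
  algebraMap_mem' := by intro r g hg v; simp [MvPolynomial.algebraMap_eq]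

/-- The representation is cofree: `𝕜[V]` is a free module over `𝕜[V]^G`. -/
def IsCofree (G : Set (Matrix (Fin n) (Fin n) 𝕜)) : Prop :=
  Module.Free ↥(invariantSubalgebra 𝕜 n G) (MvPolynomial (Fin n) 𝕜)

/-- The vanishing ideal of `π(Y)` in `𝕜[V//G] = 𝕜[V]^G`. -/
def quotVanishingIdeal (G : Set (Matrix (Fin n) (Fin n) 𝕜)) (Y : Set (Fin n → 𝕜)) :
    Ideal ↥(invariantSubalgebra 𝕜 n G) where
  carrier := {p | ∀ y ∈ Y, eval y (p : MvPolynomial (Fin n) 𝕜) = 0}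
  zero_mem' := by intro y hy; simp
  add_mem' := by intro a b ha hb y hy; simp [ha y hy, hb y hy]
  smul_mem' := by intro c p hp y hy; simp [smul_eq_mul, hp y hy]

/-- The module is stable: there is a nonempty Zariski-open set of points with closed orbit. -/
def IsStableModule (G : Set (Matrix (Fin n) (Fin n) 𝕜)) : Prop :=
  ∃ U : Set (Fin n → 𝕜), U.Nonempty ∧ IsAlgebraicSet 𝕜 n Uᶜ ∧
    ∀ v ∈ U, HasClosedOrbit 𝕜 n G v

/-- `G` is Zariski closed in `GL_n(𝕜)`. -/
def IsZClosedInGL (G : Set (Matrix (Fin n) (Fin n) 𝕜)) : Prop :=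
  ∃ P : Set (MvPolynomial (Fin n × Fin n) 𝕜),
    G = {g | IsUnit g ∧ ∀ p ∈ P, eval (fun ij => g ij.1 ij.2) p = 0}

/-- `G` is a (linearly) reductive algebraic group: a Zariski closed subgroup of `GL_n`
containing a Zariski-dense compact subgroup (the unitarian trick characterization). -/
def IsReductiveGroup (G : Set (Matrix (Fin n) (Fin n) 𝕜)) : Prop :=
  IsMatSubgroup 𝕜 n G ∧ IsZClosedInGL 𝕜 n G ∧
    ∃ K : Set (Matrix (Fin n) (Fin n) 𝕜), K ⊆ G ∧ IsCompact K ∧ IsMatSubgroup 𝕜 n K ∧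
      ∀ p : MvPolynomial (Fin n × Fin n) 𝕜,
        (∀ k ∈ K, eval (fun ij => k ij.1 ij.2) p = 0) →
          ∀ g ∈ G, eval (fun ij => g ij.1 ij.2) p = 0

/-- The isotropy groups of `v` and `w` are conjugate in `G`. -/
def ConjIsotropy (G : Set (Matrix (Fin n) (Fin n) 𝕜)) (v w : Fin n → 𝕜) : Prop :=
  ∃ g ∈ G, isotropy 𝕜 n G w = (fun h => g * h * g⁻¹) '' isotropy 𝕜 n G v

/-- The (Luna) stratum of `V` determined by a point `v` with closed orbit: the inverse image
under `π` of the set of closed orbits with isotropy group conjugate to `G_v`. -/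
def stratumOf (G : Set (Matrix (Fin n) (Fin n) 𝕜)) (v : Fin n → 𝕜) : Set (Fin n → 𝕜) :=
  {u | ∃ w, HasClosedOrbit 𝕜 n G w ∧ w ∈ zclosure 𝕜 n (orbit 𝕜 n G u) ∧
    ConjIsotropy 𝕜 n G v w}

/-- Dimension of (the Zariski closure of) a subset of `𝕜ⁿ`, as the Krull dimension of its
coordinate ring. -/
def adim (X : Set (Fin n → 𝕜)) : WithBot ℕ∞ :=
  ringKrullDim (MvPolynomial (Fin n) 𝕜 ⧸ vanishingIdeal 𝕜 n X)

/-- A nonempty algebraic set with prime vanishing ideal, i.e. an irreducible algebraic set. -/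
def IsIrredAlg (Z : Set (Fin n → 𝕜)) : Prop :=
  IsAlgebraicSet 𝕜 n Z ∧ Z.Nonempty ∧ (vanishingIdeal 𝕜 n Z).IsPrime

/-- `Z` is an irreducible component of `Y`. -/
def IsIrredComponentOf (Y Z : Set (Fin n → 𝕜)) : Prop :=
  IsIrredAlg 𝕜 n Z ∧ Z ⊆ Y ∧
    ∀ Z', IsIrredAlg 𝕜 n Z' → Z ⊆ Z' → Z' ⊆ Y → Z' = Z

/-- The rank at `v` of the differential of `f = (f_1, …, f_d) : V → 𝕜^d`. -/
def jacRank {d : ℕ} (f : Fin d → MvPolynomial (Fin n) 𝕜) (v : Fin n → 𝕜) : ℕ :=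
  (Matrix.of fun (i : Fin d) (j : Fin n) => eval v (pderiv j (f i))).rank

/-- A polynomial is `H`-invariant as a function on the submodule `N`. -/
def InvariantOn (H : Set (Matrix (Fin n) (Fin n) 𝕜)) (N : Submodule 𝕜 (Fin n → 𝕜))
    (p : MvPolynomial (Fin n) 𝕜) : Prop :=
  ∀ g ∈ H, ∀ x ∈ N, eval (Matrix.mulVec g x) p = eval x p

/-- The null cone of the `H`-module `N`: points of `N` which the `H`-invariant functions on `N`
cannot separate from `0`. -/
def sliceNullCone (H : Set (Matrix (Fin n) (Fin n) 𝕜)) (N : Submodule 𝕜 (Fin n → 𝕜)) :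
    Set (Fin n → 𝕜) :=
  {x | x ∈ N ∧ ∀ p, InvariantOn 𝕜 n H N p → eval x p = eval (0 : Fin n → 𝕜) p}

/-- The `H`-module `N` is coreduced: the vanishing ideal of its null cone in `𝕜[N]` is
generated by `H`-invariant functions.  (Stated in `𝕜[V]`: the vanishing ideal of the null
cone equals the ideal generated by the invariant functions vanishing on it together with the
vanishing ideal of `N`.) -/
def CoreducedOn (H : Set (Matrix (Fin n) (Fin n) 𝕜)) (N : Submodule 𝕜 (Fin n → 𝕜)) : Prop :=
  vanishingIdeal 𝕜 n (sliceNullCone 𝕜 n H N) =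
    Ideal.span ({p | InvariantOn 𝕜 n H N p ∧ ∀ x ∈ sliceNullCone 𝕜 n H N, eval x p = 0} ∪
      {p | ∀ x ∈ (N : Set (Fin n → 𝕜)), eval x p = 0})

/-- Complexification of a real vector. -/
def cVec (w : Fin n → ℝ) : Fin n → ℂ := fun i => (w i : ℂ)

/-- The complexification `G = K_ℂ` of a compact matrix group `K ⊆ GL_n(ℝ)`: the Zariski
closure of `K` in the complex matrices. -/
def complexifiedGroup (K : Set (Matrix (Fin n) (Fin n) ℝ)) :
    Set (Matrix (Fin n) (Fin n) ℂ) :=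
  {g | ∀ p : MvPolynomial (Fin n × Fin n) ℂ,
    (∀ k ∈ K, eval (fun ij => (k ij.1 ij.2 : ℂ)) p = 0) →
      eval (fun ij => g ij.1 ij.2) p = 0}

/-- The complexification `Y = X_ℂ ⊆ ℂⁿ` of `X ⊆ ℝⁿ`: the Zariski closure of `X` in `ℂⁿ`. -/
def complexification (X : Set (Fin n → ℝ)) : Set (Fin n → ℂ) :=
  zclosure ℂ n (cVec n '' X)

section

open scoped TensorProduct in
theorem eq_of_isNilpotent_tmul_sub {F C Ω : Type*} [Field F] [CommRing C] [Algebra F C]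
    [CommRing Ω] [IsReduced Ω] [Algebra F Ω] (c : C) (P : Polynomial F)
    (hP : RingHom.ker (Polynomial.aeval (R := F) c) = Ideal.span {P})
    (h : IsNilpotent (c ⊗ₜ[F] (1 : C) - (1 : C) ⊗ₜ[F] c)) (α β : Ω)
    (hα : Polynomial.aeval α P = 0) (hβ : Polynomial.aeval β P = 0) : α = β := by
  let I := RingHom.ker (Polynomial.aeval (R := F) c)
  let E := Polynomial F ⧸ I
  let ι : E →ₐ[F] C := Ideal.kerLiftAlg (Polynomial.aeval (R := F) c)
  have hι : Function.Injective ι := Ideal.kerLiftAlg_injective _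
  have hιι : Function.Injective (Algebra.TensorProduct.map ι ι) := by
    have h1 := Module.Flat.lTensor_preserves_injective_linearMap (M := C) ι.toLinearMap hι
    have h2 := Module.Flat.rTensor_preserves_injective_linearMap (M := E) ι.toLinearMap hι
    have : ⇑(Algebra.TensorProduct.map ι ι)
        = (LinearMap.lTensor C ι.toLinearMap) ∘ (LinearMap.rTensor E ι.toLinearMap) := by
      funext x
      induction x with
      | zero => simp
      | tmul a b => simp
      | add a b ha hb => simp only [Function.comp_apply, map_add] at *; rw [ha, hb]
    rw [this]
    exact h1.comp h2
  let x : E := Ideal.Quotient.mk I Polynomial.X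
  have hx : ι x = c := by
    change Ideal.kerLiftAlg (Polynomial.aeval (R := F) c) (Ideal.Quotient.mk _ Polynomial.X) = c
    rw [Ideal.kerLiftAlg_mk]; simp
  have hnil : IsNilpotent (x ⊗ₜ[F] (1 : E) - (1 : E) ⊗ₜ[F] x) := by
    rw [← IsNilpotent.map_iff hιι]
    simpa [hx] using h
  have key : ∀ γ : Ω, Polynomial.aeval γ P = 0 → ∃ φ : E →ₐ[F] Ω, φ x = γ := by
    intro γ hγ
    have hI : ∀ a ∈ I, Polynomial.aeval γ a = 0 := by
      intro a ha
      have ha : a ∈ Ideal.span {P} := hP ▸ ha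
      obtain ⟨b, rfl⟩ := Ideal.mem_span_singleton.1 ha
      simp [hγ]
    refine ⟨Ideal.Quotient.liftₐ I (Polynomial.aeval γ) hI, ?_⟩
    have : (Ideal.Quotient.liftₐ I (Polynomial.aeval γ) hI) (Ideal.Quotient.mk I Polynomial.X)
        = Polynomial.aeval γ Polynomial.X := Ideal.Quotient.lift_mk _ _ _
    exact this.trans (by simp)
  obtain ⟨φ, hφ⟩ := key α hα
  obtain ⟨ψ, hψ⟩ := key β hβ
  have := hnil.map (Algebra.TensorProduct.lift φ ψ (fun _ _ => Commute.all _ _))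
  simp [hφ, hψ] at this
  exact sub_eq_zero.1 this

open scoped TensorProduct in
theorem mem_range_of_isNilpotent_tmul_sub {F C : Type*} [Field F] [PerfectField F] [CommRing C]
    [Algebra F C] [IsReduced C] (c : C)
    (h : IsNilpotent (c ⊗ₜ[F] (1 : C) - (1 : C) ⊗ₜ[F] c)) : ∃ a, algebraMap F C a = c := by
  rcases subsingleton_or_nontrivial C with hC | hC
  · exact ⟨0, Subsingleton.elim _ _⟩
  obtain ⟨P, hP⟩ := (IsPrincipalIdealRing.principal
    (RingHom.ker (Polynomial.aeval (R := F) c))).principal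
  change _ = Ideal.span {P} at hP
  have key := eq_of_isNilpotent_tmul_sub (Ω := AlgebraicClosure F) c P hP h
  have hPc : Polynomial.aeval c P = 0 := by
    have : P ∈ RingHom.ker (Polynomial.aeval (R := F) c) := hP ▸ Ideal.mem_span_singleton_self P
    exact this
  have hP0 : P ≠ 0 := by
    rintro rfl
    exact zero_ne_one (key 0 1 (by simp) (by simp))
  have hsq : Squarefree P := by
    intro Q hQ
    obtain ⟨R, hR⟩ := hQ
    have h0 : Polynomial.aeval c (Q * R) = 0 := by
      have : IsNilpotent (Polynomial.aeval c (Q * R)) := by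
        refine ⟨2, ?_⟩
        rw [← map_pow, show (Q * R) ^ 2 = P * R by rw [hR]; ring, map_mul, hPc, zero_mul]
      exact this.eq_zero
    have : Q * R ∈ Ideal.span {P} := hP ▸ h0
    obtain ⟨S, hS⟩ := Ideal.mem_span_singleton.1 this
    have hQR : Q * R ≠ 0 := by
      intro h; apply hP0; rw [hR, mul_assoc, h, mul_zero]
    refine IsUnit.of_mul_eq_one S ?_
    apply mul_left_cancel₀ hQR
    rw [mul_one]; conv_rhs => rw [hS, hR]
    ring
  have hsep : P.Separable := PerfectField.separable_iff_squarefree.2 hsq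
  have hcard : P.natDegree ≤ 1 := by
    rw [← Polynomial.card_rootSet_eq_natDegree hsep
        (IsAlgClosed.splits (P.map (algebraMap F (AlgebraicClosure F)))),
      Fintype.card_le_one_iff]
    rintro ⟨a, ha⟩ ⟨b, hb⟩
    rw [Polynomial.mem_rootSet] at ha hb
    exact Subtype.ext (key a b ha.2 hb.2)
  obtain ⟨a, b, hab⟩ := Polynomial.exists_eq_X_add_C_of_natDegree_le_one hcard
  have hc : algebraMap F C a * c + algebraMap F C b = 0 := by
    rw [hab] at hPc; simpa using hPc
  have ha : a ≠ 0 := by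
    rintro rfl
    have : b = 0 := by
      apply (algebraMap F C).injective; simpa using hc
    apply hP0; rw [hab, this]; simp
  refine ⟨-b / a, ?_⟩
  rw [div_eq_inv_mul, map_mul, map_neg, ← eq_neg_of_add_eq_zero_left hc, ← mul_assoc, ← map_mul,
    inv_mul_cancel₀ ha, map_one, one_mul]

open scoped TensorProduct in
theorem exists_mul_mem_range_of_isNilpotent_tmul_sub {A B : Type*} [CommRing A] [Algebra ℚ A]
    [IsReduced A] [CommRing B] [IsReduced B] [Algebra A B] (q : Ideal A)
    (hq : q ∈ minimalPrimes A) (c : B)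
    (h : IsNilpotent (c ⊗ₜ[A] (1 : B) - (1 : B) ⊗ₜ[A] c)) :
    ∃ s ∉ q, ∃ a : A, algebraMap A B s * c = algebraMap A B a := by
  have hqp : q.IsPrime := hq.1.1
  let F := Localization.AtPrime q
  have hF : IsField F := by
    have := Ring.KrullDimLE.of_isLocalization q hq F
    exact Ring.KrullDimLE.isField_of_isReduced
  let _ : Field F := hF.toField
  have : CharZero F := algebraRat.charZero F
  let C := Localization (Algebra.algebraMapSubmonoid B q.primeCompl)
  have : IsReduced C := inferInstance
  have hnil : IsNilpotent
      ((algebraMap B C c) ⊗ₜ[F] (1 : C) - (1 : C) ⊗ₜ[F] (algebraMap B C c)) := by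
    let l : B →ₐ[A] C ⊗[F] C :=
      ((Algebra.TensorProduct.includeLeft : C →ₐ[F] C ⊗[F] C).restrictScalars A).comp
        (IsScalarTower.toAlgHom A B C)
    let r : B →ₐ[A] C ⊗[F] C :=
      ((Algebra.TensorProduct.includeRight : C →ₐ[F] C ⊗[F] C).restrictScalars A).comp
        (IsScalarTower.toAlgHom A B C)
    have := h.map (Algebra.TensorProduct.lift l r (fun _ _ => Commute.all _ _))
    simpa [l, r] using this
  obtain ⟨a, ha⟩ := mem_range_of_isNilpotent_tmul_sub _ hnil
  obtain ⟨⟨a, s⟩, hs⟩ := IsLocalization.surj q.primeCompl a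
  have h1 : algebraMap B C (algebraMap A B s * c) = algebraMap B C (algebraMap A B a) := by
    have h3 := congrArg (algebraMap F C) hs
    rw [map_mul, ha, ← IsScalarTower.algebraMap_apply, ← IsScalarTower.algebraMap_apply] at h3
    rw [map_mul, ← IsScalarTower.algebraMap_apply, ← IsScalarTower.algebraMap_apply, mul_comm]
    exact h3
  rw [IsLocalization.eq_iff_exists (Algebra.algebraMapSubmonoid B q.primeCompl)] at h1
  obtain ⟨⟨_, t, ht, rfl⟩, h2⟩ := h1
  refine ⟨t * s, q.primeCompl.mul_mem ht s.2, t * a, ?_⟩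
  simpa [mul_assoc] using h2

end

section

open scoped TensorProduct in
theorem exists_derivation_extension {k A L : Type*} [CommRing k] [CommRing A] [Field L]
    [Algebra k A] [Algebra k L] [Algebra A L] [IsScalarTower k A L]
    [Algebra.FormallySmooth A L] (D : Derivation k A L) :
    ∃ δ : Derivation k L L, ∀ a, δ (algebraMap A L a) = D a := by
  have hinj : Function.Injective (KaehlerDifferential.mapBaseChange k A L) := by
    rw [injective_iff_map_eq_zero]
    intro x hx
    obtain ⟨y, rfl⟩ := (Algebra.H1Cotangent.exact_δ_mapBaseChange k A L x).1 hx
    rw [Subsingleton.elim y 0, map_zero]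
  obtain ⟨σ, hσ⟩ := LinearMap.exists_leftInverse_of_injective _
    (LinearMap.ker_eq_bot.2 hinj)
  let ℓ : L ⊗[A] Ω[A⁄k] →ₗ[L] L := LinearMap.liftBaseChange L D.liftKaehlerDifferential
  refine ⟨(ℓ ∘ₗ σ).compDer (KaehlerDifferential.D k L), fun a => ?_⟩
  have h1 : KaehlerDifferential.mapBaseChange k A L (1 ⊗ₜ KaehlerDifferential.D k A a)
      = KaehlerDifferential.D k L (algebraMap A L a) := by simp
  have h2 := LinearMap.congr_fun hσ (1 ⊗ₜ KaehlerDifferential.D k A a)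
  change ℓ (σ (KaehlerDifferential.D k L (algebraMap A L a))) = D a
  rw [← h1]
  change σ _ = _ at h2
  rw [h2]
  simp [ℓ]

theorem formallySmooth_of_mem_minimalPrimes {A L : Type*} [CommRing A] [Algebra ℚ A]
    [IsReduced A] [Field L] [Algebra A L] [Algebra.EssFiniteType A L]
    (hq : RingHom.ker (algebraMap A L) ∈ minimalPrimes A) : Algebra.FormallySmooth A L := by
  let q := RingHom.ker (algebraMap A L)
  have hqp : q.IsPrime := hq.1.1
  let F := Localization.AtPrime q
  have hF : IsField F := by
    have := Ring.KrullDimLE.of_isLocalization q hq F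
    exact Ring.KrullDimLE.isField_of_isReduced
  let _ : Field F := hF.toField
  have : CharZero F := algebraRat.charZero F
  have hu : ∀ y : q.primeCompl, IsUnit (algebraMap A L y) := fun y =>
    isUnit_iff_ne_zero.2 fun h => y.2 h
  let _ : Algebra F L := (IsLocalization.lift (M := q.primeCompl) (S := F) hu).toAlgebra
  have : IsScalarTower A F L := IsScalarTower.of_algebraMap_eq fun x =>
    (IsLocalization.lift_eq (M := q.primeCompl) (S := F) hu x).symm
  have : Algebra.EssFiniteType F L := Algebra.EssFiniteType.of_comp A F L
  have : Algebra.FormallySmooth A F := Algebra.FormallySmooth.of_isLocalization q.primeCompl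
  exact Algebra.FormallySmooth.comp A F L

end

section

/-- The functions `(x, y) ↦ ∑ i, b i x * c i y` with `b i` in `P` and `c i` in `Q`. -/
def productFunctions {X Y : Type*} (P : Subalgebra ℂ (X → ℂ)) (Q : Subalgebra ℂ (Y → ℂ)) :
    Subalgebra ℂ (X × Y → ℂ) :=
  (Algebra.TensorProduct.lift
    ((AlgHom.pi fun z : X × Y => Pi.evalAlgHom ℂ (fun _ => ℂ) z.1).comp P.val)
    ((AlgHom.pi fun z : X × Y => Pi.evalAlgHom ℂ (fun _ => ℂ) z.2).comp Q.val)
    (fun _ _ => Commute.all _ _)).range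

theorem mul_mem_productFunctions {X Y : Type*} {P : Subalgebra ℂ (X → ℂ)}
    {Q : Subalgebra ℂ (Y → ℂ)} {b : X → ℂ} {c : Y → ℂ} (hb : b ∈ P) (hc : c ∈ Q) :
    (fun z : X × Y => b z.1 * c z.2) ∈ productFunctions P Q :=
  ⟨(⟨b, hb⟩ : P) ⊗ₜ[ℂ] (⟨c, hc⟩ : Q), by ext z; simp⟩

theorem exists_sum_of_mem_productFunctions {X Y : Type*} {P : Subalgebra ℂ (X → ℂ)}
    {Q : Subalgebra ℂ (Y → ℂ)} {f : X × Y → ℂ} (hf : f ∈ productFunctions P Q) :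
    ∃ (k : ℕ) (b : Fin k → X → ℂ) (c : Fin k → Y → ℂ), (∀ i, b i ∈ P) ∧ (∀ i, c i ∈ Q) ∧
      ∀ x y, f (x, y) = ∑ i, b i x * c i y := by
  obtain ⟨t, rfl⟩ := hf
  obtain ⟨k, b, c, rfl⟩ := TensorProduct.exists_sum_tmul_eq t
  refine ⟨k, fun i => b i, fun i => c i, fun i => (b i).2, fun i => (c i).2, fun x y => ?_⟩
  simp

variable {n : ℕ}

/-- The algebra of regular functions on a linear group. -/
def reg (Γ : Subgroup (GL (Fin n) ℂ)) : Subalgebra ℂ (Γ → ℂ) :=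
  Algebra.adjoin ℂ
    (Set.range (fun (ij : Fin n × Fin n) (g : Γ) => (g : GL (Fin n) ℂ).1 ij.1 ij.2) ∪
      Set.range (fun (ij : Fin n × Fin n) (g : Γ) => (g⁻¹ : Γ).1.1 ij.1 ij.2))

variable {Γ : Subgroup (GL (Fin n) ℂ)}

theorem entry_mem_reg (i j : Fin n) : (fun g : Γ => g.1.1 i j) ∈ reg Γ :=
  Algebra.subset_adjoin (Or.inl ⟨(i, j), rfl⟩)

theorem inv_entry_mem_reg (i j : Fin n) : (fun g : Γ => (g⁻¹ : Γ).1.1 i j) ∈ reg Γ :=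
  Algebra.subset_adjoin (Or.inr ⟨(i, j), rfl⟩)

theorem reg_le_of_mem {S : Subalgebra ℂ (Γ → ℂ)} (h1 : ∀ i j, (fun g : Γ => g.1.1 i j) ∈ S)
    (h2 : ∀ i j, (fun g : Γ => (g⁻¹ : Γ).1.1 i j) ∈ S) : reg Γ ≤ S := by
  refine Algebra.adjoin_le ?_
  rintro _ (⟨⟨i, j⟩, rfl⟩ | ⟨⟨i, j⟩, rfl⟩)
  · exact h1 i j
  · exact h2 i j

/-- Pullback of functions along a map, as an algebra homomorphism. -/
def pullback {X Y : Type*} (φ : X → Y) : (Y → ℂ) →ₐ[ℂ] (X → ℂ) :=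
  AlgHom.pi fun x => Pi.evalAlgHom ℂ (fun _ => ℂ) (φ x)

@[simp] theorem pullback_apply {X Y : Type*} (φ : X → Y) (f : Y → ℂ) (x : X) :
    pullback φ f x = f (φ x) := rfl

theorem inv_mem_reg {b : Γ → ℂ} (hb : b ∈ reg Γ) : (fun g => b g⁻¹) ∈ reg Γ := by
  have : reg Γ ≤ (reg Γ).comap (pullback fun g : Γ => g⁻¹) := by
    refine reg_le_of_mem (fun i j => inv_entry_mem_reg i j) fun i j => ?_
    have := entry_mem_reg (Γ := Γ) i j
    rw [Subalgebra.mem_comap]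
    convert this using 2
    simp
  exact this hb

theorem exists_coproduct {b : Γ → ℂ} (hb : b ∈ reg Γ) :
    ∃ (k : ℕ) (b' b'' : Fin k → Γ → ℂ), (∀ i, b' i ∈ reg Γ) ∧ (∀ i, b'' i ∈ reg Γ) ∧
      ∀ g h, b (g * h) = ∑ i, b' i g * b'' i h := by
  have : reg Γ ≤ (productFunctions (reg Γ) (reg Γ)).comap
      (pullback fun z : Γ × Γ => z.1 * z.2) := by
    refine reg_le_of_mem (fun i j => ?_) fun i j => ?_
    · have : (pullback fun z : Γ × Γ => z.1 * z.2) (fun g : Γ => g.1.1 i j)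
          = ∑ k, fun z : Γ × Γ => (fun g : Γ => g.1.1 i k) z.1 * (fun g : Γ => g.1.1 k j) z.2 := by
        ext z; simp [Matrix.mul_apply]
      rw [Subalgebra.mem_comap, this]
      exact sum_mem fun k _ => mul_mem_productFunctions (entry_mem_reg i k) (entry_mem_reg k j)
    · have : (pullback fun z : Γ × Γ => z.1 * z.2) (fun g : Γ => (g⁻¹ : Γ).1.1 i j)
          = ∑ k, fun z : Γ × Γ => (fun g : Γ => (g⁻¹ : Γ).1.1 k j) z.1
            * (fun g : Γ => (g⁻¹ : Γ).1.1 i k) z.2 := by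
        ext z; simp [Matrix.mul_apply, mul_comm, -Matrix.coe_units_inv]
      rw [Subalgebra.mem_comap, this]
      exact sum_mem fun k _ =>
        mul_mem_productFunctions (inv_entry_mem_reg k j) (inv_entry_mem_reg i k)
  exact exists_sum_of_mem_productFunctions (this hb)

/-- The algebra of polynomial functions. -/
def polyFun (n : ℕ) : Subalgebra ℂ ((Fin n → ℂ) → ℂ) :=
  (AlgHom.pi fun x : Fin n → ℂ => (MvPolynomial.aeval x : MvPolynomial (Fin n) ℂ →ₐ[ℂ] ℂ)).range

/-- The action of the group on points. -/
def act (g : Γ) (x : Fin n → ℂ) : Fin n → ℂ := Matrix.mulVec g.1.1 x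

theorem act_mul (g h : Γ) (x : Fin n → ℂ) : act (g * h) x = act g (act h x) := by
  simp [act]

@[simp] theorem act_one (x : Fin n → ℂ) : act (1 : Γ) x = x := by
  simp [act]

theorem exists_coaction (Γ : Subgroup (GL (Fin n) ℂ)) (p : MvPolynomial (Fin n) ℂ) :
    ∃ (k : ℕ) (b : Fin k → Γ → ℂ) (f : Fin k → MvPolynomial (Fin n) ℂ), (∀ i, b i ∈ reg Γ) ∧
      ∀ g x, eval (act g x) p = ∑ i, b i g * eval x (f i) := by
  let φ : MvPolynomial (Fin n) ℂ →ₐ[ℂ] (Γ × (Fin n → ℂ) → ℂ) :=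
    AlgHom.pi fun z => MvPolynomial.aeval (act z.1 z.2)
  have hφ : ∀ p, φ p ∈ productFunctions (reg Γ) (polyFun n) := by
    intro p
    have : φ = MvPolynomial.aeval (fun i => φ (X i)) := MvPolynomial.algHom_ext (by simp)
    have h2 : φ p ∈ φ.range := ⟨p, rfl⟩
    have h3 : φ.range = Algebra.adjoin ℂ (Set.range fun i => φ (X i)) := by
      rw [Algebra.adjoin_range_eq_range_aeval, ← this]
    rw [h3] at h2
    refine Algebra.adjoin_le ?_ h2
    rintro _ ⟨i, rfl⟩
    have : φ (X i) = ∑ j, fun z : Γ × (Fin n → ℂ) => (fun g : Γ => g.1.1 i j) z.1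
        * (fun x : Fin n → ℂ => x j) z.2 := by
      ext z; simp [φ, act, Matrix.mulVec, dotProduct]
    change φ (X i) ∈ _
    rw [this]
    exact sum_mem fun k _ => mul_mem_productFunctions (entry_mem_reg i k)
      (show (fun x : Fin n → ℂ => x k) ∈ polyFun n from ⟨X k, by ext; simp⟩)
  obtain ⟨k, b, c, hb, hc, h⟩ := exists_sum_of_mem_productFunctions (hφ p)
  choose f hf using hc
  refine ⟨k, b, f, hb, fun g x => ?_⟩
  have := h g x
  simp only [← hf] at this
  simpa [φ, MvPolynomial.aeval_eq_eval] using this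

theorem orb_mem_reg (x : Fin n → ℂ) (p : MvPolynomial (Fin n) ℂ) :
    (fun g : Γ => eval (act g x) p) ∈ reg Γ := by
  obtain ⟨k, b, f, hb, h⟩ := exists_coaction Γ p
  have : (fun g : Γ => eval (act g x) p) = ∑ i, (eval x (f i)) • b i := by
    ext g; simp [h, mul_comm]
  rw [this]
  exact sum_mem fun i _ => Subalgebra.smul_mem _ (hb i) _

theorem left_mem_reg {b : Γ → ℂ} (hb : b ∈ reg Γ) (h : Γ) : (fun g => b (h * g)) ∈ reg Γ := by
  obtain ⟨k, b', b'', hb', hb'', e⟩ := exists_coproduct hb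
  have : (fun g => b (h * g)) = ∑ i, (b' i h) • b'' i := by ext g; simp [e]
  rw [this]
  exact sum_mem fun i _ => Subalgebra.smul_mem _ (hb'' i) _

theorem right_mem_reg {b : Γ → ℂ} (hb : b ∈ reg Γ) (h : Γ) : (fun g => b (g * h)) ∈ reg Γ := by
  obtain ⟨k, b', b'', hb', hb'', e⟩ := exists_coproduct hb
  have : (fun g => b (g * h)) = ∑ i, (b'' i h) • b' i := by ext g; simp [e, mul_comm]
  rw [this]
  exact sum_mem fun i _ => Subalgebra.smul_mem _ (hb' i) _

theorem exists_det_pow_mul_eq_eval {b : Γ → ℂ} (hb : b ∈ reg Γ) :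
    ∃ (N : ℕ) (P : MvPolynomial (Fin n × Fin n) ℂ), ∀ g : Γ,
      (g.1.1.det) ^ N * b g = eval (fun ij => g.1.1 ij.1 ij.2) P := by
  let dp : MvPolynomial (Fin n × Fin n) ℂ := Matrix.det (Matrix.of fun i j => X (i, j))
  have hd : ∀ g : Γ, eval (fun ij => g.1.1 ij.1 ij.2) dp = g.1.1.det := by
    intro g
    rw [show dp = _ from rfl, RingHom.map_det]
    congr 1; ext i j; simp
  have ha : ∀ (i j) (g : Γ), eval (fun ij => g.1.1 ij.1 ij.2)
      (Matrix.adjugate (Matrix.of fun i j => X (i, j)) i j : MvPolynomial (Fin n × Fin n) ℂ)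
      = g.1.1.adjugate i j := by
    intro i j g
    have := RingHom.map_adjugate (eval (fun ij => g.1.1 ij.1 ij.2))
      (Matrix.of fun i j => X (i, j) : Matrix _ _ (MvPolynomial (Fin n × Fin n) ℂ))
    have h2 := congrFun (congrFun this i) j
    rw [RingHom.mapMatrix_apply, Matrix.map_apply] at h2
    rw [h2]
    congr 2; ext i j; simp
  induction hb using Algebra.adjoin_induction with
  | mem x hx =>
    rcases hx with ⟨⟨i, j⟩, rfl⟩ | ⟨⟨i, j⟩, rfl⟩
    · exact ⟨0, X (i, j), fun g => by simp⟩
    · refine ⟨1, Matrix.adjugate (Matrix.of fun i j => X (i, j)) i j, fun g => ?_⟩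
      rw [ha]
      have hu : IsUnit g.1.1.det := (Matrix.isUnit_iff_isUnit_det _).1 g.1.isUnit
      have : (g⁻¹ : Γ).1.1 = (g.1.1)⁻¹ := by simp
      simp only [this, Matrix.inv_def]
      simp [← mul_assoc, mul_inv_cancel₀ hu.ne_zero]
  | algebraMap r => exact ⟨0, C r, fun g => by simp⟩
  | add x y _ _ hx hy =>
    obtain ⟨N, P, hP⟩ := hx
    obtain ⟨M, Q, hQ⟩ := hy
    refine ⟨N + M, dp ^ M * P + dp ^ N * Q, fun g => ?_⟩
    simp only [map_add, map_mul, map_pow, hd, ← hP, ← hQ, Pi.add_apply]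
    ring
  | mul x y _ _ hx hy =>
    obtain ⟨N, P, hP⟩ := hx
    obtain ⟨M, Q, hQ⟩ := hy
    refine ⟨N + M, P * Q, fun g => ?_⟩
    simp only [map_mul, ← hP, ← hQ, Pi.mul_apply]
    ring

theorem eq_zero_of_dense {K : Subgroup (GL (Fin n) ℂ)} (hKΓ : K ≤ Γ)
    (hK : ∀ p : MvPolynomial (Fin n × Fin n) ℂ,
      (∀ k ∈ K, eval (fun ij => k.1 ij.1 ij.2) p = 0) →
        ∀ g ∈ Γ, eval (fun ij => g.1 ij.1 ij.2) p = 0) {b : Γ → ℂ} (hb : b ∈ reg Γ)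
    (h : ∀ k (hk : k ∈ K), b ⟨k, hKΓ hk⟩ = 0) : b = 0 := by
  obtain ⟨N, P, hP⟩ := exists_det_pow_mul_eq_eval hb
  ext g
  have h1 := hK P (fun k hk => by rw [← hP ⟨k, hKΓ hk⟩, h k hk, mul_zero]) g.1 g.2
  rw [← hP g] at h1
  have hu : IsUnit g.1.1.det := (Matrix.isUnit_iff_isUnit_det _).1 g.1.isUnit
  exact (mul_eq_zero.1 h1).resolve_left (pow_ne_zero _ hu.ne_zero)

end

section

variable {n : ℕ} {Γ : Subgroup (GL (Fin n) ℂ)}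

open MeasureTheory in
theorem exists_haar_functional (K : Type*) [Group K] [TopologicalSpace K] [IsTopologicalGroup K]
    [CompactSpace K] :
    ∃ L : (K → ℂ) → ℂ, L 1 = 1 ∧ (∀ a b, Continuous a → Continuous b → L (a + b) = L a + L b) ∧
      (∀ (c : ℂ) a, L (c • a) = c * L a) ∧
      (∀ a h, L (fun k => a (h * k)) = L a) ∧ (∀ a h, L (fun k => a (k * h)) = L a) := by
  borelize K
  let μ : Measure K := Measure.haarMeasure ⊤
  have : IsProbabilityMeasure μ := ⟨Measure.haarMeasure_self⟩
  have hr : μ.IsMulRightInvariant := by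
    refine ⟨fun h => ?_⟩
    have h1 : IsProbabilityMeasure (μ.map (· * h)) :=
      Measure.isProbabilityMeasure_map (measurable_mul_const h).aemeasurable
    have h2 : (μ.map (· * h)).IsHaarMeasure := inferInstance
    exact Measure.isHaarMeasure_eq_of_isProbabilityMeasure _ _
  have hi : ∀ a : K → ℂ, Continuous a → Integrable a μ := fun a ha =>
    ha.integrable_of_hasCompactSupport (HasCompactSupport.of_compactSpace a)
  refine ⟨fun a => ∫ k, a k ∂μ, by simp, fun a b ha hb => integral_add (hi a ha) (hi b hb),
    fun c a => integral_const_mul c a, fun a h => integral_mul_left_eq_self a h,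
    fun a h => integral_mul_right_eq_self a h⟩

/-- A normalized bi-invariant linear functional on the regular functions. -/
structure IsReynolds (Γ : Subgroup (GL (Fin n) ℂ)) (Λ : (Γ → ℂ) →ₗ[ℂ] ℂ) : Prop where
  one : Λ 1 = 1
  left : ∀ b ∈ reg Γ, ∀ h, Λ (fun g => b (h * g)) = Λ b
  right : ∀ b ∈ reg Γ, ∀ h, Λ (fun g => b (g * h)) = Λ b

theorem continuous_restrict_reg {K : Subgroup (GL (Fin n) ℂ)} (hKΓ : K ≤ Γ) {b : Γ → ℂ}
    (hb : b ∈ reg Γ) : Continuous fun k : K => b ⟨k, hKΓ k.2⟩ := by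
  induction hb using Algebra.adjoin_induction with
  | mem x hx =>
    rcases hx with ⟨⟨i, j⟩, rfl⟩ | ⟨⟨i, j⟩, rfl⟩
    · exact (Units.continuous_val.comp continuous_subtype_val).matrix_elem i j
    · exact (Units.continuous_val.comp
        (continuous_inv.comp continuous_subtype_val)).matrix_elem i j
  | algebraMap r => exact continuous_const
  | add x y _ _ hx hy => exact hx.add hy
  | mul x y _ _ hx hy => exact hx.mul hy

theorem exists_isReynolds {K : Subgroup (GL (Fin n) ℂ)} (hKΓ : K ≤ Γ)
    (hc : IsCompact (K : Set (GL (Fin n) ℂ)))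
    (hK : ∀ p : MvPolynomial (Fin n × Fin n) ℂ,
      (∀ k ∈ K, eval (fun ij => k.1 ij.1 ij.2) p = 0) →
        ∀ g ∈ Γ, eval (fun ij => g.1 ij.1 ij.2) p = 0) :
    ∃ Λ, IsReynolds Γ Λ := by
  have : CompactSpace K := isCompact_iff_compactSpace.1 hc
  obtain ⟨L, L1, Ladd, Lsmul, Lleft, Lright⟩ := exists_haar_functional K
  let r : (Γ → ℂ) → (K → ℂ) := fun b k => b ⟨k, hKΓ k.2⟩
  let Λ₀ : (reg Γ).toSubmodule →ₗ[ℂ] ℂ :=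
    { toFun := fun b => L (r b)
      map_add' := fun a b => Ladd _ _ (continuous_restrict_reg hKΓ a.2)
        (continuous_restrict_reg hKΓ b.2)
      map_smul' := fun c a => Lsmul c _ }
  obtain ⟨Λ, hΛ⟩ := LinearMap.exists_extend Λ₀
  have hΛ' : ∀ b ∈ reg Γ, Λ b = L (r b) := fun b hb => LinearMap.congr_fun hΛ ⟨b, hb⟩
  refine ⟨Λ, ?_, ?_, ?_⟩
  · rw [hΛ' 1 (one_mem _)]; exact L1
  · intro b hb h
    obtain ⟨k, b', b'', hb', hb'', e⟩ := exists_coproduct hb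
    have e1 : ∀ h, Λ (fun g => b (h * g)) = ∑ i, b' i h * Λ (b'' i) := by
      intro h
      have : (fun g => b (h * g)) = ∑ i, (b' i h) • b'' i := by ext g; simp [e]
      rw [this]; simp
    have e2 := eq_zero_of_dense hKΓ hK
      (b := (∑ i, (Λ (b'' i)) • b' i) - (Λ b) • (1 : Γ → ℂ))
      (sub_mem (sum_mem fun i _ => Subalgebra.smul_mem _ (hb' i) _)
        (Subalgebra.smul_mem _ (one_mem _) _)) (by
        intro k hk
        have := e1 ⟨k, hKΓ hk⟩
        rw [hΛ' _ (left_mem_reg hb _)] at this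
        have h3 : L (r fun g => b (⟨k, hKΓ hk⟩ * g)) = Λ b := by
          rw [hΛ' b hb]; exact Lleft (r b) ⟨k, hk⟩
        simp [mul_comm, ← this, h3])
    have e3 := congrFun e2 h
    rw [e1 h]
    simpa [sub_eq_zero, mul_comm] using e3
  · intro b hb h
    obtain ⟨k, b', b'', hb', hb'', e⟩ := exists_coproduct hb
    have e1 : ∀ h, Λ (fun g => b (g * h)) = ∑ i, b'' i h * Λ (b' i) := by
      intro h
      have : (fun g => b (g * h)) = ∑ i, (b'' i h) • b' i := by ext g; simp [e, mul_comm]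
      rw [this]; simp
    have e2 := eq_zero_of_dense hKΓ hK
      (b := (∑ i, (Λ (b' i)) • b'' i) - (Λ b) • (1 : Γ → ℂ))
      (sub_mem (sum_mem fun i _ => Subalgebra.smul_mem _ (hb'' i) _)
        (Subalgebra.smul_mem _ (one_mem _) _)) (by
        intro k hk
        have := e1 ⟨k, hKΓ hk⟩
        rw [hΛ' _ (right_mem_reg hb _)] at this
        have h3 : L (r fun g => b (g * ⟨k, hKΓ hk⟩)) = Λ b := by
          rw [hΛ' b hb]; exact Lright (r b) ⟨k, hk⟩
        simp [mul_comm, ← this, h3])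
    have e3 := congrFun e2 h
    rw [e1 h]
    simpa [sub_eq_zero, mul_comm] using e3

/-- The subgroup of `GL_n` underlying a group of matrices. -/
def glSubgroup (G : Set (Matrix (Fin n) (Fin n) ℂ)) (hG : IsMatSubgroup ℂ n G) :
    Subgroup (GL (Fin n) ℂ) where
  carrier := {u | u.1 ∈ G}
  one_mem' := hG.1
  mul_mem' := fun ha hb => hG.2.1 _ ha _ hb
  inv_mem' := fun {u} hu => by
    have := (hG.2.2 u.1 hu).2
    simpa using this

theorem exists_mem_glSubgroup {G : Set (Matrix (Fin n) (Fin n) ℂ)} (hG : IsMatSubgroup ℂ n G)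
    {a : Matrix (Fin n) (Fin n) ℂ} (ha : a ∈ G) : ∃ g : glSubgroup G hG, g.1.1 = a := by
  obtain ⟨u, rfl⟩ := (hG.2.2 a ha).1
  exact ⟨⟨u, ha⟩, rfl⟩

open Matrix.Norms.Operator in
theorem isCompact_glSubgroup {K : Set (Matrix (Fin n) (Fin n) ℂ)} (hK : IsMatSubgroup ℂ n K)
    (hc : IsCompact K) : IsCompact (glSubgroup K hK : Set (GL (Fin n) ℂ)) := by
  have he : Topology.IsOpenEmbedding (Units.val : GL (Fin n) ℂ → Matrix (Fin n) (Fin n) ℂ) :=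
    Units.isOpenEmbedding_val
  refine he.isInducing.isCompact_preimage' (K := K) hc fun a ha => ?_
  obtain ⟨g, hg⟩ := exists_mem_glSubgroup hK ha
  exact ⟨g.1, hg⟩

theorem IsReductiveGroup.exists_isReynolds {G : Set (Matrix (Fin n) (Fin n) ℂ)}
    (hG : IsReductiveGroup ℂ n G) : ∃ Λ, IsReynolds (glSubgroup G hG.1) Λ := by
  obtain ⟨h1, -, K, hKG, hc, hK, hd⟩ := hG
  refine ZPaper.exists_isReynolds (K := glSubgroup K hK) (fun k hk => hKG hk)
    (isCompact_glSubgroup hK hc) fun p hp g hg => hd p (fun k hk => ?_) g.1 hg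
  obtain ⟨g, rfl⟩ := exists_mem_glSubgroup hK hk
  exact hp g.1 g.2

end

section

variable {n : ℕ} {Γ : Subgroup (GL (Fin n) ℂ)}

theorem exists_algHom_of_isMaximal {B : Type*} [CommRing B] [Algebra ℂ B]
    [Algebra.FiniteType ℂ B] (m : Ideal B) (hm : m.IsMaximal) :
    ∃ χ : B →ₐ[ℂ] ℂ, RingHom.ker χ = m := by
  let _ : Field (B ⧸ m) := Ideal.Quotient.field m
  have : Module.Finite ℂ (B ⧸ m) := finite_of_finite_type_of_isJacobsonRing ℂ (B ⧸ m)
  have : Algebra.IsAlgebraic ℂ (B ⧸ m) := Algebra.IsAlgebraic.of_finite ℂ (B ⧸ m)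
  let e : (B ⧸ m) →ₐ[ℂ] ℂ := IsAlgClosed.lift
  refine ⟨e.comp (Ideal.Quotient.mkₐ ℂ m), ?_⟩
  ext b
  rw [RingHom.mem_ker, AlgHom.comp_apply, map_eq_zero_iff e e.toRingHom.injective]
  exact Ideal.Quotient.eq_zero_iff_mem

theorem exists_algHom_ne_zero_of_notMem {B : Type*} [CommRing B] [Algebra ℂ B]
    [Algebra.FiniteType ℂ B] (I : Ideal B) (hI : I.IsRadical) {b : B} (hb : b ∉ I) :
    ∃ χ : B →ₐ[ℂ] ℂ, (∀ a ∈ I, χ a = 0) ∧ χ b ≠ 0 := by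
  have : IsJacobsonRing B := isJacobsonRing_of_finiteType (A := ℂ)
  rw [← IsJacobsonRing.out inferInstance hI, Ideal.jacobson, Submodule.mem_sInf] at hb
  push Not at hb
  obtain ⟨m, ⟨hIm, hm⟩, hbm⟩ := hb
  obtain ⟨χ, hχ⟩ := exists_algHom_of_isMaximal m hm
  refine ⟨χ, fun a ha => ?_, fun h => hbm ?_⟩
  · have := hIm ha
    rw [← hχ] at this
    exact this
  · rw [← hχ]; exact h

theorem isNilpotent_of_forall_algHom {B : Type*} [CommRing B] [Algebra ℂ B]
    [Algebra.FiniteType ℂ B] {b : B} (hb : ∀ χ : B →ₐ[ℂ] ℂ, χ b = 0) : IsNilpotent b := by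
  by_contra h
  obtain ⟨χ, -, h1⟩ := exists_algHom_ne_zero_of_notMem (nilradical B)
    (Ideal.radical_isRadical _) (b := b) (by rwa [mem_nilradical])
  exact h1 (hb χ)

theorem exists_forall_eval_eq_zero {I : Ideal (MvPolynomial (Fin n) ℂ)} (hI : I ≠ ⊤) :
    ∃ x, ∀ p ∈ I, eval x p = 0 := by
  obtain ⟨m, hm, hIm⟩ := Ideal.exists_le_maximal I hI
  obtain ⟨χ, hχ⟩ := exists_algHom_of_isMaximal m hm
  refine ⟨fun i => χ (X i), fun p hp => ?_⟩
  have h1 : χ p = 0 := by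
    have := hIm hp
    rw [← hχ] at this
    exact this
  have h2 : χ = MvPolynomial.aeval (fun i => χ (X i)) := MvPolynomial.algHom_ext (by simp)
  rw [h2, MvPolynomial.aeval_eq_eval] at h1
  exact h1

/-- Every character of the ring of regular functions is evaluation at a point of the group. -/
def IsAffineGroup (Γ : Subgroup (GL (Fin n) ℂ)) : Prop :=
  ∀ χ : reg Γ →ₐ[ℂ] ℂ, ∃ g : Γ, ∀ b : reg Γ, χ b = b.1 g

theorem isAffineGroup_glSubgroup {G : Set (Matrix (Fin n) (Fin n) ℂ)} (hG : IsMatSubgroup ℂ n G)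
    (hz : IsZClosedInGL ℂ n G) : IsAffineGroup (glSubgroup G hG) := by
  intro χ
  obtain ⟨P, hP⟩ := hz
  let Γ := glSubgroup G hG
  let x : Fin n → Fin n → reg Γ := fun i j => ⟨_, entry_mem_reg i j⟩
  let z : Fin n → Fin n → reg Γ := fun i j => ⟨_, inv_entry_mem_reg i j⟩
  let a : Matrix (Fin n) (Fin n) ℂ := Matrix.of fun i j => χ (x i j)
  let b : Matrix (Fin n) (Fin n) ℂ := Matrix.of fun i j => χ (z i j)
  have hxz : ∀ i j, ∑ k, x i k * z k j = algebraMap ℂ _ ((1 : Matrix (Fin n) (Fin n) ℂ) i j) := by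
    intro i j
    apply Subtype.ext
    ext g
    have h1 : g.1.1 * (g⁻¹ : Γ).1.1 = 1 := by
      rw [← Units.val_mul, ← Subgroup.coe_mul, mul_inv_cancel]; rfl
    have h2 := congrFun (congrFun h1 i) j
    rw [Matrix.mul_apply] at h2
    simpa [x, z, -Matrix.coe_units_inv, -Subgroup.coe_inv] using h2
  have hab : a * b = 1 := by
    ext i j
    have := congrArg χ (hxz i j)
    rw [map_sum, AlgHom.commutes] at this
    simpa [a, b, Matrix.mul_apply] using this
  have haG : a ∈ G := by
    rw [hP]
    refine ⟨IsUnit.of_mul_eq_one b hab, fun p hp => ?_⟩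
    have h1 : MvPolynomial.aeval (fun ij : Fin n × Fin n => x ij.1 ij.2) p = 0 := by
      apply Subtype.ext
      ext g
      have hg : g.1.1 ∈ G := g.2
      rw [hP] at hg
      have h2 := hg.2 p hp
      have h3 : ((Pi.evalAlgHom ℂ (fun _ : Γ => ℂ) g).comp (reg Γ).val).comp
          (MvPolynomial.aeval (fun ij : Fin n × Fin n => x ij.1 ij.2))
          = MvPolynomial.aeval (fun ij => g.1.1 ij.1 ij.2) :=
        MvPolynomial.algHom_ext (by simp [x])
      have h4 := DFunLike.congr_fun h3 p
      rw [MvPolynomial.aeval_eq_eval] at h4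
      exact h4.trans h2
    have h3 : χ.comp (MvPolynomial.aeval (fun ij : Fin n × Fin n => x ij.1 ij.2))
          = MvPolynomial.aeval (fun ij => a ij.1 ij.2) :=
        MvPolynomial.algHom_ext (by simp [a])
    have h4 := DFunLike.congr_fun h3 p
    rw [MvPolynomial.aeval_eq_eval] at h4
    rw [← h4]
    exact (congrArg χ h1).trans (map_zero χ)
  obtain ⟨g, hg⟩ := exists_mem_glSubgroup hG haG
  refine ⟨g, fun b' => ?_⟩
  have hb : b = (g⁻¹ : Γ).1.1 := by
    have : g.1.1 * (g⁻¹ : Γ).1.1 = 1 := by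
      rw [← Units.val_mul, ← Subgroup.coe_mul, mul_inv_cancel]; rfl
    rw [hg] at this
    exact (left_inv_eq_right_inv (mul_eq_one_comm.1 hab) this)
  obtain ⟨b', hb'⟩ := b'
  induction hb' using Algebra.adjoin_induction with
  | mem y hy =>
    rcases hy with ⟨⟨i, j⟩, rfl⟩ | ⟨⟨i, j⟩, rfl⟩
    · exact (congrFun (congrFun hg i) j).symm
    · exact (congrFun (congrFun hb i) j)
  | algebraMap r => exact χ.commutes r
  | add y z hy hz h1 h2 => 
    have := map_add χ ⟨y, hy⟩ ⟨z, hz⟩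
    rw [h1, h2] at this
    exact this
  | mul y z hy hz h1 h2 => 
    have := map_mul χ ⟨y, hy⟩ ⟨z, hz⟩
    rw [h1, h2] at this
    exact this

instance : Algebra.FiniteType ℂ (reg Γ) := by
  rw [← Subalgebra.fg_iff_finiteType]
  exact Subalgebra.fg_def.2 ⟨_, (Set.finite_range _).union (Set.finite_range _), rfl⟩

instance : IsReduced (reg Γ) :=
  isReduced_of_injective (reg Γ).val Subtype.val_injective

/-- Linear substitution in polynomials. -/
def translate (A : Matrix (Fin n) (Fin n) ℂ) :
    MvPolynomial (Fin n) ℂ →ₐ[ℂ] MvPolynomial (Fin n) ℂ :=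
  MvPolynomial.aeval fun i => ∑ j, C (A i j) * X j

theorem eval_translate (A : Matrix (Fin n) (Fin n) ℂ) (p : MvPolynomial (Fin n) ℂ)
    (x : Fin n → ℂ) : eval x (translate A p) = eval (A.mulVec x) p := by
  have : (MvPolynomial.aeval x).comp (translate A)
      = (MvPolynomial.aeval (A.mulVec x) : MvPolynomial (Fin n) ℂ →ₐ[ℂ] ℂ) :=
    MvPolynomial.algHom_ext (by simp [translate, Matrix.mulVec, dotProduct])
  have := DFunLike.congr_fun this p
  simpa [MvPolynomial.aeval_eq_eval] using this

theorem eval_translate_act (g : Γ) (p : MvPolynomial (Fin n) ℂ) (x : Fin n → ℂ) :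
    eval x (translate g.1.1 p) = eval (act g x) p := eval_translate _ _ _

/-- Restriction of polynomials to an orbit, as functions on the group. -/
def orbMap (Γ : Subgroup (GL (Fin n) ℂ)) (y : Fin n → ℂ) :
    MvPolynomial (Fin n) ℂ →ₐ[ℂ] reg Γ :=
  (AlgHom.pi fun g : Γ => MvPolynomial.aeval (act g y)).codRestrict (reg Γ) fun p => by
    convert orb_mem_reg y p using 1
    ext g
    simp [MvPolynomial.aeval_eq_eval]

@[simp] theorem orbMap_apply (y : Fin n → ℂ) (p : MvPolynomial (Fin n) ℂ) (g : Γ) :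
    (orbMap Γ y p).1 g = eval (act g y) p := by
  simp [orbMap, MvPolynomial.aeval_eq_eval]

/-- The ideal of polynomials vanishing on an orbit. -/
def orbIdeal (Γ : Subgroup (GL (Fin n) ℂ)) (y : Fin n → ℂ) : Ideal (MvPolynomial (Fin n) ℂ) :=
  vanishingIdeal ℂ n (Set.range fun g : Γ => act g y)

theorem mem_orbIdeal {y : Fin n → ℂ} {p : MvPolynomial (Fin n) ℂ} :
    p ∈ orbIdeal Γ y ↔ ∀ g : Γ, eval (act g y) p = 0 :=
  Set.forall_mem_range

/-- The orbit is Zariski closed. -/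
def ClosedOrb (Γ : Subgroup (GL (Fin n) ℂ)) (y : Fin n → ℂ) : Prop :=
  ∀ x, (∀ p ∈ orbIdeal Γ y, eval x p = 0) → ∃ g : Γ, act g y = x

theorem ClosedOrb.eq_top {y : Fin n → ℂ} (hy : ClosedOrb Γ y)
    {I : Ideal (MvPolynomial (Fin n) ℂ)} (hI : orbIdeal Γ y ≤ I)
    (hs : ∀ (h : Γ), ∀ p ∈ I, translate h.1.1 p ∈ I) {p : MvPolynomial (Fin n) ℂ} (hp : p ∈ I)
    (hpy : p ∉ orbIdeal Γ y) : I = ⊤ := by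
  by_contra hne
  obtain ⟨x, hx⟩ := exists_forall_eval_eq_zero hne
  obtain ⟨g, rfl⟩ := hy x fun p hp => hx p (hI hp)
  refine hpy (mem_orbIdeal.2 fun h => ?_)
  have := hx _ (hs (h * g⁻¹) p hp)
  rwa [eval_translate_act, ← act_mul, inv_mul_cancel_right] at this

variable {Λ : (Γ → ℂ) →ₗ[ℂ] ℂ}

theorem exists_average (Λ : (Γ → ℂ) →ₗ[ℂ] ℂ) (b : Γ → ℂ) (p : MvPolynomial (Fin n) ℂ) :
    ∃ q : MvPolynomial (Fin n) ℂ, ∀ x, eval x q = Λ (fun g => b g * eval (act g x) p) := by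
  obtain ⟨k, b', f, hb, h⟩ := exists_coaction Γ p
  refine ⟨∑ i, C (Λ (b * b' i)) * f i, fun x => ?_⟩
  have : (fun g => b g * eval (act g x) p) = ∑ i, (eval x (f i)) • (b * b' i) := by
    ext g
    simp only [h, Finset.mul_sum, Finset.sum_apply, Pi.smul_apply, Pi.mul_apply, smul_eq_mul]
    exact Finset.sum_congr rfl fun i _ => by ring
  rw [this]
  simp [mul_comm]

/-- The average of a polynomial against a function on the group. -/
def average (Λ : (Γ → ℂ) →ₗ[ℂ] ℂ) (b : Γ → ℂ) (p : MvPolynomial (Fin n) ℂ) :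
    MvPolynomial (Fin n) ℂ := (exists_average Λ b p).choose

theorem eval_average (Λ : (Γ → ℂ) →ₗ[ℂ] ℂ) (b : Γ → ℂ) (p : MvPolynomial (Fin n) ℂ)
    (x : Fin n → ℂ) : eval x (average Λ b p) = Λ (fun g => b g * eval (act g x) p) :=
  (exists_average Λ b p).choose_spec x

theorem IsReynolds.eval_act_average_one (hΛ : IsReynolds Γ Λ) (p : MvPolynomial (Fin n) ℂ)
    (h : Γ) (x : Fin n → ℂ) : eval (act h x) (average Λ 1 p) = eval x (average Λ 1 p) := by
  rw [eval_average, eval_average]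
  have := hΛ.right _ (orb_mem_reg x p) h
  simpa [act_mul] using this

theorem IsReynolds.exists_eq_one (hΛ : IsReynolds Γ Λ) {y : Fin n → ℂ} (hy : ClosedOrb Γ y)
    {q : MvPolynomial (Fin n) ℂ} (hq : q ∉ orbIdeal Γ y) :
    ∃ p, Λ (fun g => eval (act g y) p * eval (act g y) q) = 1 := by
  let I : Ideal (MvPolynomial (Fin n) ℂ) :=
    { carrier := {q | ∀ p, Λ (fun g => eval (act g y) p * eval (act g y) q) = 0}
      zero_mem' := fun p => by
        have : (fun g : Γ => eval (act g y) p * eval (act g y) 0) = 0 := by ext; simp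
        rw [this, map_zero]
      add_mem' := fun {a b} ha hb p => by
        have : (fun g : Γ => eval (act g y) p * eval (act g y) (a + b))
            = (fun g : Γ => eval (act g y) p * eval (act g y) a)
              + (fun g : Γ => eval (act g y) p * eval (act g y) b) := by
          ext; simp [mul_add]
        rw [this, map_add, ha, hb, add_zero]
      smul_mem' := fun c a ha p => by
        have := ha (p * c)
        simpa [mul_assoc] using this }
  have h0 : orbIdeal Γ y ≤ I := fun q hq p => by
    have : (fun g : Γ => eval (act g y) p * eval (act g y) q) = 0 := by
      ext g; simp [mem_orbIdeal.1 hq g]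
    rw [this, map_zero]
  have hs : ∀ (h : Γ), ∀ p ∈ I, translate h.1.1 p ∈ I := by
    intro h q hq p
    have h1 := hq (translate (h⁻¹ : Γ).1.1 p)
    have h2 := hΛ.left _ (mul_mem (orb_mem_reg y (translate (h⁻¹ : Γ).1.1 p)) (orb_mem_reg y q)) h
    have h3 : (fun g : Γ => ((fun g : Γ => eval (act g y) (translate (h⁻¹ : Γ).1.1 p))
        * (fun g : Γ => eval (act g y) q)) (h * g))
        = fun g : Γ => eval (act g y) p * eval (act g y) (translate h.1.1 q) := by
      ext g
      simp only [Pi.mul_apply, eval_translate_act, ← act_mul, inv_mul_cancel_left]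
    rw [h3] at h2
    rw [h2]
    exact h1
  have hqI : q ∉ I := by
    intro h
    have h1 : (1 : MvPolynomial (Fin n) ℂ) ∈ I := by
      rw [hy.eq_top h0 hs h hq]; trivial
    have h2 := h1 1
    have h3 : (fun g : Γ => eval (act g y) (1 : MvPolynomial (Fin n) ℂ) *
        eval (act g y) (1 : MvPolynomial (Fin n) ℂ)) = 1 := by ext; simp
    rw [h3, hΛ.one] at h2
    exact one_ne_zero h2
  have : ∃ p, Λ (fun g => eval (act g y) p * eval (act g y) q) ≠ 0 := by
    by_contra! h
    exact hqI h
  obtain ⟨p, hp⟩ := this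
  refine ⟨C (Λ (fun g => eval (act g y) p * eval (act g y) q))⁻¹ * p, ?_⟩
  have h3 : (fun g : Γ => eval (act g y)
        (C (Λ (fun g => eval (act g y) p * eval (act g y) q))⁻¹ * p) * eval (act g y) q)
      = (Λ (fun g => eval (act g y) p * eval (act g y) q))⁻¹ •
        (fun g : Γ => eval (act g y) p * eval (act g y) q) := by
    ext g; simp [mul_assoc]
  rw [h3, map_smul, smul_eq_mul, inv_mul_cancel₀ hp]

end

section

open scoped TensorProduct in
theorem isNilpotent_tmul_sub {A B : Type*} [CommRing A] [CommRing B] [Algebra ℂ A]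
    [Algebra ℂ B] [Algebra A B] [IsScalarTower ℂ A B] [Algebra.FiniteType ℂ B] (c : B)
    (hc : ∀ χ ψ : B →ₐ[ℂ] ℂ, (∀ a : A, χ (algebraMap A B a) = ψ (algebraMap A B a)) → χ c = ψ c) :
    IsNilpotent (c ⊗ₜ[A] (1 : B) - (1 : B) ⊗ₜ[A] c) := by
  have : Algebra.FiniteType A B := Algebra.FiniteType.of_restrictScalars_finiteType ℂ A B
  have : Algebra.FiniteType ℂ (B ⊗[A] B) :=
    Algebra.FiniteType.trans (inferInstance : Algebra.FiniteType ℂ B)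
      (inferInstance : Algebra.FiniteType B (B ⊗[A] B))
  refine isNilpotent_of_forall_algHom (B := B ⊗[A] B) fun χ => ?_
  let l : B →ₐ[ℂ] B ⊗[A] B :=
    (Algebra.TensorProduct.includeLeft : B →ₐ[A] B ⊗[A] B).restrictScalars ℂ
  let r : B →ₐ[ℂ] B ⊗[A] B :=
    (Algebra.TensorProduct.includeRight : B →ₐ[A] B ⊗[A] B).restrictScalars ℂ
  rw [map_sub]
  refine sub_eq_zero.2 (hc (χ.comp l) (χ.comp r) fun a => congrArg χ ?_)
  exact (AlgHom.commutes (Algebra.TensorProduct.includeLeft : B →ₐ[A] B ⊗[A] B) a).trans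
    (AlgHom.commutes (Algebra.TensorProduct.includeRight : B →ₐ[A] B ⊗[A] B) a).symm

theorem exists_ne_zero_forall_mul_mem_range {A B : Type*} [CommRing A] [CommRing B] [Algebra ℂ A]
    [Algebra ℂ B] [Algebra A B] [IsScalarTower ℂ A B] [Algebra.FiniteType ℂ B]
    [IsReduced A] [IsReduced B] [Nontrivial A] {m : ℕ} (c : Fin m → B)
    (hc : ∀ χ ψ : B →ₐ[ℂ] ℂ, (∀ a : A, χ (algebraMap A B a) = ψ (algebraMap A B a)) →
      ∀ i, χ (c i) = ψ (c i)) :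
    ∃ s : A, s ≠ 0 ∧ ∀ i, ∃ a : A, algebraMap A B s * c i = algebraMap A B a := by
  let _ : Algebra ℚ A := Algebra.compHom A (algebraMap ℚ ℂ)
  obtain ⟨q, hq⟩ := Ideal.nonempty_minimalPrimes (I := (⊥ : Ideal A)) bot_ne_top
  have hqp : q.IsPrime := hq.1.1
  choose s hs a ha using fun i => exists_mul_mem_range_of_isNilpotent_tmul_sub q hq (c i)
    (isNilpotent_tmul_sub (c i) fun χ ψ h => hc χ ψ h i)
  refine ⟨∏ i, s i, fun h => ?_, fun i => ⟨(∏ j ∈ Finset.univ.erase i, s j) * a i, ?_⟩⟩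
  · have h1 : ∏ i, s i ∈ q := h ▸ q.zero_mem
    obtain ⟨i, -, hi⟩ := (Ideal.IsPrime.prod_mem_iff).1 h1
    exact hs i hi
  · rw [← Finset.prod_erase_mul _ _ (Finset.mem_univ i), map_mul, map_mul, mul_assoc, ha]

theorem exists_map_ne_zero_forall_mul_eq {R B : Type*} [CommRing R] [CommRing B] [Algebra ℂ R]
    [Algebra ℂ B] [Algebra.FiniteType ℂ B] [IsReduced B] [Nontrivial B] (φ : R →ₐ[ℂ] B) {m : ℕ}
    (c : Fin m → B)
    (hc : ∀ χ ψ : B →ₐ[ℂ] ℂ, (∀ a : R, χ (φ a) = ψ (φ a)) → ∀ i, χ (c i) = ψ (c i)) :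
    ∃ p : R, φ p ≠ 0 ∧ ∀ i, ∃ e : R, φ p * c i = φ e := by
  have : IsReduced φ.range := isReduced_of_injective φ.range.val Subtype.val_injective
  obtain ⟨⟨_, p, rfl⟩, hp, h⟩ := exists_ne_zero_forall_mul_mem_range (A := φ.range) c
    fun χ ψ h => hc χ ψ fun a => h ⟨φ a, a, rfl⟩
  refine ⟨p, fun h => hp (Subtype.ext h), fun i => ?_⟩
  obtain ⟨⟨_, e, rfl⟩, he⟩ := h i
  exact ⟨e, he⟩

variable {n : ℕ} {Γ : Subgroup (GL (Fin n) ℂ)} {Λ : (Γ → ℂ) →ₗ[ℂ] ℂ}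

theorem eq_of_forall_eval_eq {x y : Fin n → ℂ}
    (h : ∀ p : MvPolynomial (Fin n) ℂ, eval x p = eval y p) : x = y := by
  ext i
  simpa using h (X i)

theorem exists_eq_orbMap (hN : IsAffineGroup Γ) {y : Fin n → ℂ} (hy : ClosedOrb Γ y) {m : ℕ}
    (c : Fin m → Γ → ℂ) (hcr : ∀ i, c i ∈ reg Γ)
    (hc : ∀ i (g h : Γ), act g y = act h y → c i g = c i h)
    (hs : ∀ (h : Γ) i, ∃ γ : Fin m → ℂ, ∀ g, c i (h * g) = ∑ l, γ l * c l g) :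
    ∃ e : Fin m → MvPolynomial (Fin n) ℂ, ∀ i g, c i g = eval (act g y) (e i) := by
  obtain ⟨p, hp0, hp⟩ := exists_map_ne_zero_forall_mul_eq (orbMap Γ y)
    (fun i => ⟨c i, hcr i⟩) (by
      intro χ ψ h i
      obtain ⟨g, hg⟩ := hN χ
      obtain ⟨h', hh⟩ := hN ψ
      rw [hg, hh]
      refine hc i g h' (eq_of_forall_eval_eq fun p => ?_)
      rw [← orbMap_apply, ← orbMap_apply, ← hg, ← hh, h])
  let I : Ideal (MvPolynomial (Fin n) ℂ) :=
    { carrier := {p | ∀ i, ∃ e, ∀ g, eval (act g y) p * c i g = eval (act g y) e}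
      zero_mem' := fun i => ⟨0, by simp⟩
      add_mem' := fun {a b} ha hb i => by
        obtain ⟨e, he⟩ := ha i
        obtain ⟨f, hf⟩ := hb i
        exact ⟨e + f, fun g => by simp [add_mul, he, hf]⟩
      smul_mem' := fun r a ha i => by
        obtain ⟨e, he⟩ := ha i
        exact ⟨r * e, fun g => by simp [mul_assoc, he]⟩ }
  have h0 : orbIdeal Γ y ≤ I := fun q hq i => ⟨0, fun g => by simp [mem_orbIdeal.1 hq g]⟩
  have hst : ∀ (h : Γ), ∀ p ∈ I, translate h.1.1 p ∈ I := by
    intro h p hp i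
    obtain ⟨γ, hγ⟩ := hs h⁻¹ i
    choose e he using hp
    refine ⟨∑ l, C (γ l) * translate h.1.1 (e l), fun g => ?_⟩
    have h1 := hγ (h * g)
    rw [inv_mul_cancel_left] at h1
    simp only [h1, Finset.mul_sum, map_sum, map_mul, eval_C, eval_translate_act, ← act_mul, ← he]
    exact Finset.sum_congr rfl fun l _ => by ring
  have hmem : p ∈ I := by
    intro i
    obtain ⟨e, he⟩ := hp i
    refine ⟨e, fun g => ?_⟩
    have := congrFun (congrArg Subtype.val he) g
    simpa using this
  have hnot : p ∉ orbIdeal Γ y := by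
    intro h
    apply hp0
    apply Subtype.ext
    ext g
    rw [orbMap_apply, mem_orbIdeal.1 h g]
    rfl
  have h1 : (1 : MvPolynomial (Fin n) ℂ) ∈ I := by
    rw [hy.eq_top h0 hst hmem hnot]; trivial
  choose e he using h1
  exact ⟨e, fun i g => by simpa using he i g⟩

end

section

theorem eq_top_of_forall_dotProduct_eq_zero {m : ℕ} (W : Submodule ℂ (Fin m → ℂ))
    (h : ∀ φ : Fin m → ℂ, (∀ v ∈ W, ∑ k, φ k * v k = 0) → φ = 0) : W = ⊤ := by
  by_contra hW
  obtain ⟨f, hf0, hf⟩ := Submodule.exists_le_ker_of_lt_top W (lt_top_iff_ne_top.2 hW)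
  apply hf0
  have e : ∀ v, f v = ∑ k, f (Pi.single k 1) * v k := fun v => by
    conv_lhs => rw [pi_eq_sum_univ' v]
    simp [mul_comm]
  have h1 := h (fun k => f (Pi.single k 1)) fun v hv => by
    rw [← e]; exact hf hv
  ext v
  simp [congrFun h1]

variable {n : ℕ} {Γ : Subgroup (GL (Fin n) ℂ)} {Λ : (Γ → ℂ) →ₗ[ℂ] ℂ}

theorem exists_matrix_coefficients (M C : Submodule ℂ (Γ → ℂ)) [FiniteDimensional ℂ M]
    (hMC : M ≤ C) (hl : ∀ c ∈ M, ∀ h, (fun g => c (h * g)) ∈ M)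
    (hr : ∀ c ∈ C, ∀ h, (fun g => c (g * h)) ∈ C) :
    ∃ (c : Fin (Module.finrank ℂ M) → Γ → ℂ)
      (γ : Fin (Module.finrank ℂ M) → Fin (Module.finrank ℂ M) → Γ → ℂ),
      LinearIndependent ℂ c ∧ (∀ k, c k ∈ M) ∧ (∀ k l, γ k l ∈ C) ∧
      ∀ k h g, c k (h * g) = ∑ l, γ k l h * c l g := by
  let bas := Module.finBasis ℂ M
  let c : Fin (Module.finrank ℂ M) → Γ → ℂ := fun k => bas k
  have hli : LinearIndependent ℂ c :=
    bas.linearIndependent.map' M.subtype (Submodule.ker_subtype M)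
  let γ : Fin (Module.finrank ℂ M) → Fin (Module.finrank ℂ M) → Γ → ℂ :=
    fun k l h => bas.repr ⟨_, hl (c k) (bas k).2 h⟩ l
  have hγ : ∀ k h g, c k (h * g) = ∑ l, γ k l h * c l g := by
    intro k h g
    have := congrFun (congrArg Subtype.val (bas.sum_repr ⟨_, hl (c k) (bas k).2 h⟩)) g
    simp only [Submodule.coe_sum, Finset.sum_apply] at this
    rw [← this]
    rfl
  refine ⟨c, γ, hli, fun k => (bas k).2, ?_, hγ⟩
  intro k l
  let W : Submodule ℂ (Fin (Module.finrank ℂ M) → ℂ) :=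
    C.comap (Fintype.linearCombination ℂ (γ k))
  have hW : W = ⊤ := by
    refine eq_top_of_forall_dotProduct_eq_zero W fun φ hφ => ?_
    have h1 : ∀ g, (fun l => c l g) ∈ W := by
      intro g
      have : Fintype.linearCombination ℂ (γ k) (fun l => c l g) = fun h => c k (h * g) := by
        ext h
        simp [Fintype.linearCombination_apply, hγ, mul_comm]
      rw [Submodule.mem_comap, this]
      exact hr _ (hMC (bas k).2) g
    have h2 : ∑ l, φ l • c l = 0 := by
      ext g
      simpa using hφ _ (h1 g)
    ext l
    exact Fintype.linearIndependent_iff.1 hli φ h2 l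
  have h1 : Pi.single l 1 ∈ W := hW ▸ trivial
  have h2 : Fintype.linearCombination ℂ (γ k) (Pi.single l 1) = γ k l := by
    rw [Fintype.linearCombination_apply_single, one_smul]
  rwa [Submodule.mem_comap, h2] at h1

/-- The span of all the functions `g ↦ f (h g x)`. -/
def translatesSpan (Γ : Subgroup (GL (Fin n) ℂ)) (f : MvPolynomial (Fin n) ℂ) :
    Submodule ℂ (Γ → ℂ) :=
  Submodule.span ℂ (Set.range fun hx : Γ × (Fin n → ℂ) => fun g : Γ =>
    eval (act (hx.1 * g) hx.2) f)

theorem translatesSpan_le_reg (f : MvPolynomial (Fin n) ℂ) :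
    translatesSpan Γ f ≤ (reg Γ).toSubmodule := by
  rw [translatesSpan, Submodule.span_le]
  rintro _ ⟨⟨h, x⟩, rfl⟩
  exact left_mem_reg (orb_mem_reg x f) h

theorem finiteDimensional_translatesSpan (f : MvPolynomial (Fin n) ℂ) :
    FiniteDimensional ℂ (translatesSpan Γ f) := by
  obtain ⟨k, b, p, hb, hp⟩ := exists_coaction Γ f
  choose K b' b'' hb' hb'' e using fun i => exists_coproduct (hb i)
  have hle : translatesSpan Γ f ≤
      Submodule.span ℂ (Set.range fun ij : (Σ i : Fin k, Fin (K i)) => b'' ij.1 ij.2) := by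
    rw [translatesSpan, Submodule.span_le]
    rintro _ ⟨⟨h, x⟩, rfl⟩
    have : (fun g : Γ => eval (act (h * g) x) f)
        = ∑ i, ∑ j, (eval x (p i) * b' i j h) • b'' i j := by
      ext g
      simp only [hp, e, Finset.sum_mul, Finset.sum_apply, Pi.smul_apply, smul_eq_mul]
      exact Finset.sum_congr rfl fun i _ => Finset.sum_congr rfl fun j _ => by ring
    change (fun g : Γ => eval (act (h * g) x) f) ∈ _
    rw [this]
    exact Submodule.sum_mem _ fun i _ => Submodule.sum_mem _ fun j _ =>
      Submodule.smul_mem _ _ (Submodule.subset_span ⟨⟨i, j⟩, rfl⟩)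
  have : FiniteDimensional ℂ
      (Submodule.span ℂ (Set.range fun ij : (Σ i : Fin k, Fin (K i)) => b'' ij.1 ij.2)) :=
    FiniteDimensional.span_of_finite ℂ (Set.finite_range _)
  exact Submodule.finiteDimensional_of_le hle

theorem left_mem_translatesSpan {f : MvPolynomial (Fin n) ℂ} {c : Γ → ℂ}
    (hc : c ∈ translatesSpan Γ f) (h : Γ) : (fun g => c (h * g)) ∈ translatesSpan Γ f := by
  unfold translatesSpan at hc
  induction hc using Submodule.span_induction with
  | mem c hc =>
    obtain ⟨⟨h', x⟩, rfl⟩ := hc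
    simp only [← mul_assoc]
    exact Submodule.subset_span ⟨⟨h' * h, x⟩, rfl⟩
  | zero => exact Submodule.zero_mem _
  | add a b _ _ ha hb => exact Submodule.add_mem _ ha hb
  | smul r a _ ha => exact Submodule.smul_mem _ r ha

theorem right_mem_translatesSpan {f : MvPolynomial (Fin n) ℂ} {c : Γ → ℂ}
    (hc : c ∈ translatesSpan Γ f) (h : Γ) : (fun g => c (g * h)) ∈ translatesSpan Γ f := by
  unfold translatesSpan at hc
  induction hc using Submodule.span_induction with
  | mem c hc =>
    obtain ⟨⟨h', x⟩, rfl⟩ := hc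
    simp only [← mul_assoc, act_mul _ h]
    exact Submodule.subset_span ⟨⟨h', act h x⟩, rfl⟩
  | zero => exact Submodule.zero_mem _
  | add a b _ _ ha hb => exact Submodule.add_mem _ ha hb
  | smul r a _ ha => exact Submodule.smul_mem _ r ha

/-- The functions in `translatesSpan Γ f` which are invariant under the isotropy group of `y`. -/
def orbitTranslates (Γ : Subgroup (GL (Fin n) ℂ)) (f : MvPolynomial (Fin n) ℂ) (y : Fin n → ℂ) :
    Submodule ℂ (Γ → ℂ) where
  carrier := {c | c ∈ translatesSpan Γ f ∧ ∀ g h : Γ, act h y = y → c (g * h) = c g}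
  zero_mem' := ⟨Submodule.zero_mem _, by simp⟩
  add_mem' := fun ha hb => ⟨Submodule.add_mem _ ha.1 hb.1, fun g h hh => by
    simp [ha.2 g h hh, hb.2 g h hh]⟩
  smul_mem' := fun r c hc => ⟨Submodule.smul_mem _ r hc.1, fun g h hh => by simp [hc.2 g h hh]⟩

theorem exists_equivariant_generators (hΛ : IsReynolds Γ Λ) (hN : IsAffineGroup Γ)
    {y : Fin n → ℂ} (hy : ClosedOrb Γ y) (f : MvPolynomial (Fin n) ℂ) :
    ∃ (e E : Fin (Module.finrank ℂ (orbitTranslates Γ f y)) → MvPolynomial (Fin n) ℂ),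
      (∀ x, (∀ h : Γ, act h y = y → act h x = x) →
        ∀ k, (fun g => eval (act g x) (e k)) ∈ orbitTranslates Γ f y) ∧
      ∀ k j, Λ (fun g => eval (act g y) (e k) * eval (act g y) (E j)) = if k = j then 1 else 0 := by
  have hfd := finiteDimensional_translatesSpan (Γ := Γ) f
  have hle : orbitTranslates Γ f y ≤ translatesSpan Γ f := fun c hc => hc.1
  have : FiniteDimensional ℂ (orbitTranslates Γ f y) := Submodule.finiteDimensional_of_le hle
  obtain ⟨c, γ, hli, hcM, hγC, hγ⟩ := exists_matrix_coefficients (orbitTranslates Γ f y)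
    (translatesSpan Γ f) hle (fun c hc h => ⟨left_mem_translatesSpan hc.1 h, fun g h' hh => by
      show c (h * (g * h')) = c (h * g)
      rw [← mul_assoc]; exact hc.2 _ _ hh⟩) (fun c hc h => right_mem_translatesSpan hc h)
  have hcr : ∀ k, c k ∈ reg Γ := fun k => translatesSpan_le_reg f (hle (hcM k))
  have hγr : ∀ k l, γ k l ∈ reg Γ := fun k l => translatesSpan_le_reg f (hγC k l)
  have hγm : ∀ k l h h', γ k l (h * h') = ∑ j, γ k j h * γ j l h' := by
    intro k l h h'
    have h1 : ∑ l, (γ k l (h * h') - ∑ j, γ k j h * γ j l h') • c l = 0 := by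
      ext g
      have h2 := hγ k (h * h') g
      rw [mul_assoc, hγ k h (h' * g)] at h2
      simp only [hγ _ h' g, Finset.mul_sum] at h2
      rw [Finset.sum_comm] at h2
      simp only [Finset.sum_apply, Pi.smul_apply, smul_eq_mul, sub_mul, Finset.sum_sub_distrib,
        ← h2, Finset.sum_mul, Pi.zero_apply]
      rw [sub_eq_zero]
      exact Finset.sum_congr rfl fun l _ => Finset.sum_congr rfl fun j _ => by ring
    exact sub_eq_zero.1 (Fintype.linearIndependent_iff.1 hli _ h1 l)
  obtain ⟨e, he⟩ := exists_eq_orbMap hN hy c hcr (by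
      intro i g h hgh
      have := (hcM i).2 g (g⁻¹ * h) (by rw [act_mul, ← hgh, ← act_mul, inv_mul_cancel, act_one])
      rw [← this, mul_inv_cancel_left]) fun h i => ⟨fun l => γ i l h, fun g => hγ i h g⟩
  let e' : Fin (Module.finrank ℂ (orbitTranslates Γ f y)) → MvPolynomial (Fin n) ℂ :=
    fun k => ∑ l, average Λ (fun g => γ k l g⁻¹) (e l)
  have he' : ∀ k x, eval x (e' k) = Λ (fun g => ∑ l, γ k l g⁻¹ * eval (act g x) (e l)) := by
    intro k x
    simp only [e', map_sum, eval_average]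
    rw [← map_sum]
    congr 1
    ext g; simp
  have he'r : ∀ k x, (fun g => ∑ l, γ k l g⁻¹ * eval (act g x) (e l)) ∈ reg Γ := by
    intro k x
    have : (fun g => ∑ l, γ k l g⁻¹ * eval (act g x) (e l))
        = ∑ l, (fun g => γ k l g⁻¹) * (fun g => eval (act g x) (e l)) := by ext g; simp
    rw [this]
    exact sum_mem fun l _ => mul_mem (inv_mem_reg (hγr k l)) (orb_mem_reg x _)
  have heq : ∀ k h x, eval (act h x) (e' k) = ∑ j, γ k j h * eval x (e' j) := by
    intro k h x
    have h1 := hΛ.right _ (he'r k (act h x)) h⁻¹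
    simp only [← act_mul, inv_mul_cancel_right, mul_inv_rev, inv_inv, hγm, Finset.sum_mul] at h1
    rw [he']
    simp only [← act_mul] at h1 ⊢
    rw [← h1]
    simp only [he', ← smul_eq_mul (a := γ k _ h)]
    simp only [← map_smul]
    rw [← map_sum]
    congr 1
    ext g
    simp only [Finset.sum_apply, Pi.smul_apply, smul_eq_mul, Finset.mul_sum]
    rw [Finset.sum_comm]
    exact Finset.sum_congr rfl fun l _ => Finset.sum_congr rfl fun j _ => by ring
  have hey : ∀ k g, eval (act g y) (e' k) = c k g := by
    intro k h
    rw [he']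
    have : (fun g => ∑ l, γ k l g⁻¹ * eval (act g (act h y)) (e l)) = c k h • (1 : Γ → ℂ) := by
      ext g
      simp only [← act_mul, ← he, ← hγ]
      simp
    rw [this, map_smul, hΛ.one, smul_eq_mul, mul_one]
  let W : Submodule ℂ (Fin (Module.finrank ℂ (orbitTranslates Γ f y)) → ℂ) :=
    LinearMap.range (LinearMap.pi fun k => Λ ∘ₗ LinearMap.mulLeft ℂ (c k) ∘ₗ
      (reg Γ).val.toLinearMap ∘ₗ (orbMap Γ y).toLinearMap)
  have hW : W = ⊤ := by
    refine eq_top_of_forall_dotProduct_eq_zero W fun φ hφ => ?_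
    have h1 : ∑ k, C (φ k) * e k ∈ orbIdeal Γ y := by
      by_contra hq
      obtain ⟨p, hp⟩ := hΛ.exists_eq_one hy hq
      have h2 := hφ _ ⟨p, rfl⟩
      have h3 : ∑ k, φ k * Λ (c k * (orbMap Γ y p).1) = 1 := by
        rw [← hp]
        simp only [← smul_eq_mul (a := φ _), ← map_smul]
        rw [← map_sum]
        congr 1
        ext g
        simp only [Finset.sum_apply, Pi.smul_apply, Pi.mul_apply, smul_eq_mul, orbMap_apply,
          map_sum, map_mul, eval_C, ← he, Finset.mul_sum]
        exact Finset.sum_congr rfl fun k _ => by ring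
      exact one_ne_zero (h3.symm.trans h2)
    have h2 : ∑ l, φ l • c l = 0 := by
      ext g
      have := mem_orbIdeal.1 h1 g
      simpa [he] using this
    ext l
    exact Fintype.linearIndependent_iff.1 hli φ h2 l
  have hE : ∀ j, ∃ p, ∀ k, Λ (c k * (orbMap Γ y p).1) = if k = j then 1 else 0 := by
    intro j
    have h1 : (fun k => if k = j then 1 else 0) ∈ W := hW ▸ trivial
    obtain ⟨p, hp⟩ := h1
    exact ⟨p, fun k => congrFun hp k⟩
  choose E hE using hE
  refine ⟨e', E, fun x hx k => ⟨?_, ?_⟩, fun k j => ?_⟩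
  · have : (fun g => eval (act g x) (e' k)) = ∑ j, eval x (e' j) • γ k j := by
      ext g; simp [heq, mul_comm]
    rw [this]
    exact Submodule.sum_mem _ fun j _ => Submodule.smul_mem _ _ (hγC k j)
  · intro g h hh
    simp only [act_mul, hx h hh]
  · rw [← hE j k]
    congr 1
    ext g
    simp [hey]

end

section

variable {n : ℕ} {Γ : Subgroup (GL (Fin n) ℂ)} {Λ : (Γ → ℂ) →ₗ[ℂ] ℂ}

/-- Denominator-free form of the local statement that the vanishing ideal of a principal orbit
is generated by invariants. -/
theorem exists_invariant_mul_mem (hΛ : IsReynolds Γ Λ) (hN : IsAffineGroup Γ)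
    {y : Fin n → ℂ} (hy : ClosedOrb Γ y)
    (hd : ∀ p : MvPolynomial (Fin n) ℂ, (∀ x, (∀ h : Γ, act h y = y → act h x = x) →
      ∀ g : Γ, eval (act g x) p = 0) → p = 0) (f : MvPolynomial (Fin n) ℂ) :
    ∃ b : MvPolynomial (Fin n) ℂ, (∀ (g : Γ) x, eval (act g x) b = eval x b) ∧ eval y b = 1 ∧
      ∀ J : Ideal (MvPolynomial (Fin n) ℂ), (∀ p, average Λ 1 (f * p) ∈ J) → f * b ∈ J := by
  have hfd : FiniteDimensional ℂ (orbitTranslates Γ f y) :=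
    have := finiteDimensional_translatesSpan (Γ := Γ) f
    Submodule.finiteDimensional_of_le (S₂ := translatesSpan Γ f) fun c hc => hc.1
  obtain ⟨e, E, he, heE⟩ := exists_equivariant_generators hΛ hN hy f
  let R := average (Γ := Γ) (n := n) Λ 1
  have hR : ∀ p (g : Γ) x, eval (act g x) (R p) = eval x (R p) := hΛ.eval_act_average_one
  let B := Matrix.of fun k j => R (e k * E j)
  let D := Matrix.fromBlocks (Matrix.of fun _ _ : Unit => f)
    (Matrix.of fun (_ : Unit) j => R (f * E j)) (Matrix.of fun k (_ : Unit) => e k) B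
  have hD : D.det = 0 := by
    refine hd _ fun x hx g => ?_
    let F : Unit ⊕ Fin (Module.finrank ℂ (orbitTranslates Γ f y)) → MvPolynomial (Fin n) ℂ :=
      Sum.elim (fun _ => f) e
    have hF : ∀ s, (fun g => eval (act g x) (F s)) ∈ orbitTranslates Γ f y := by
      rintro (_ | k)
      · refine ⟨Submodule.subset_span ⟨⟨1, x⟩, by simp [F]⟩, fun g h hh => ?_⟩
        simp [F, act_mul, hx h hh]
      · exact he x hx k
    have hnl : ¬ LinearIndependent ℂ fun s => (⟨_, hF s⟩ : orbitTranslates Γ f y) := by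
      intro hli
      have := hli.fintype_card_le_finrank
      simp at this
    obtain ⟨β, hβ, s₀, hs₀⟩ := Fintype.not_linearIndependent_iff.1 hnl
    have hβ' : ∀ g : Γ, ∑ s, β s * eval (act g x) (F s) = 0 := by
      intro g
      have := congrFun (congrArg Subtype.val hβ) g
      simpa using this
    rw [RingHom.map_det]
    refine Matrix.exists_vecMul_eq_zero_iff.1 ⟨β, fun h => hs₀ (congrFun h s₀), ?_⟩
    have hDF : ∀ s j, (eval (act g x)).mapMatrix D s (Sum.inr j) = eval x (R (F s * E j)) := by
      rintro (_ | k) j <;> simp [D, F, B, hR]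
    ext (_ | j)
    · refine Eq.trans ?_ (hβ' g)
      simp [Matrix.vecMul, dotProduct, D, F]
    · have h1 : ∑ s, β s • (fun g : Γ => eval (act g x) (F s) * eval (act g x) (E j)) = 0 := by
        ext g
        simp only [Finset.sum_apply, Pi.smul_apply, smul_eq_mul, ← mul_assoc, ← Finset.sum_mul,
          hβ', zero_mul, Pi.zero_apply]
      simp only [Matrix.vecMul, dotProduct, hDF, Pi.zero_apply]
      rw [← map_zero Λ, ← h1, map_sum]
      simp [R, eval_average]
  refine ⟨B.det, ?_, ?_, fun J hJ => ?_⟩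
  · intro g x
    rw [RingHom.map_det, RingHom.map_det]
    congr 1
    ext k j
    simp [B, hR]
  · rw [RingHom.map_det]
    have : (eval y).mapMatrix B = 1 := by
      ext k j
      simp [B, R, eval_average, heE, Matrix.one_apply]
    rw [this, Matrix.det_one]
  · have h1 : (Ideal.Quotient.mk J) D.det = 0 := by rw [hD, map_zero]
    rw [← Ideal.Quotient.eq_zero_iff_mem, map_mul, ← h1, RingHom.map_det _ D]
    have h2 : (Ideal.Quotient.mk J).mapMatrix D = Matrix.fromBlocks
        (Matrix.of fun _ _ : Unit => Ideal.Quotient.mk J f) 0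
        (Matrix.of fun k (_ : Unit) => Ideal.Quotient.mk J (e k))
        ((Ideal.Quotient.mk J).mapMatrix B) := by
      ext (_ | k) (_ | j)
      · simp [D]
      · simpa [D] using Ideal.Quotient.eq_zero_iff_mem.2 (hJ (E j))
      · simp [D]
      · simp [D]
    rw [h2, Matrix.det_fromBlocks_zero₁₂, Matrix.det_unique (n := Unit), Matrix.of_apply,
      RingHom.map_det]

end

section

variable {n : ℕ} {Γ : Subgroup (GL (Fin n) ℂ)} {Λ : (Γ → ℂ) →ₗ[ℂ] ℂ}

theorem average_one_mul_of_invariant {b : MvPolynomial (Fin n) ℂ}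
    (hb : ∀ (g : Γ) x, eval (act g x) b = eval x b) (a : MvPolynomial (Fin n) ℂ) :
    average Λ 1 (a * b) = average Λ 1 a * b := by
  refine MvPolynomial.funext fun x => ?_
  simp only [eval_average, map_mul, hb]
  rw [mul_comm (Λ _), ← smul_eq_mul, ← map_smul]
  congr 1
  ext g
  simp [mul_comm]

theorem average_one_add (a b : MvPolynomial (Fin n) ℂ) :
    average Λ 1 (a + b) = average Λ 1 a + average Λ 1 b := by
  refine MvPolynomial.funext fun x => ?_
  simp only [eval_average, map_add]
  rw [← map_add]
  congr 1
  ext g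
  simp

theorem IsReynolds.average_one_one (hΛ : IsReynolds Γ Λ) :
    average Λ 1 (1 : MvPolynomial (Fin n) ℂ) = 1 := by
  refine MvPolynomial.funext fun x => ?_
  simp only [eval_average, map_one, mul_one]
  exact hΛ.one

theorem mem_span_invariants (hΛ : IsReynolds Γ Λ) (hN : IsAffineGroup Γ) {Y : Set (Fin n → ℂ)}
    (hYa : IsAlgebraicSet ℂ n Y) (hYs : ∀ (g : Γ), ∀ y ∈ Y, act g y ∈ Y)
    (hY : ∀ y ∈ Y, ∃ g : Γ, ClosedOrb Γ (act g y) ∧ ∀ p : MvPolynomial (Fin n) ℂ,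
      (∀ x, (∀ h : Γ, act h (act g y) = act g y → act h x = x) →
        ∀ g : Γ, eval (act g x) p = 0) → p = 0)
    {f : MvPolynomial (Fin n) ℂ} (hf : f ∈ vanishingIdeal ℂ n Y) :
    f ∈ Ideal.span {p : MvPolynomial (Fin n) ℂ |
      (∀ (g : Γ) x, eval (act g x) p = eval x p) ∧ ∀ x ∈ Y, eval x p = 0} := by
  set J := Ideal.span {p : MvPolynomial (Fin n) ℂ |
      (∀ (g : Γ) x, eval (act g x) p = eval x p) ∧ ∀ x ∈ Y, eval x p = 0} with hJ
  have hRJ : ∀ q ∈ vanishingIdeal ℂ n Y, average Λ 1 q ∈ J := by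
    intro q hq
    refine Ideal.subset_span ⟨hΛ.eval_act_average_one q, fun x hx => ?_⟩
    rw [eval_average, ← map_zero Λ]
    congr 1
    ext g
    simp [hq _ (hYs g x hx)]
  let S : Set (MvPolynomial (Fin n) ℂ) :=
    {b | (∀ (g : Γ) x, eval (act g x) b = eval x b) ∧ f * b ∈ J}
  by_cases hS : Ideal.span S = ⊤
  · have h1 : ∀ q ∈ Ideal.span S, ∀ a, f * average Λ 1 (a * q) ∈ J := by
      intro q hq
      induction hq using Submodule.span_induction with
      | mem b hb =>
        intro a
        rw [average_one_mul_of_invariant hb.1, mul_left_comm]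
        exact J.mul_mem_left _ hb.2
      | zero =>
        intro a
        rw [average_one_mul_of_invariant (by simp), mul_zero, mul_zero]
        exact J.zero_mem
      | add x y _ _ hx hy =>
        intro a
        rw [mul_add, average_one_add, mul_add]
        exact J.add_mem (hx a) (hy a)
      | smul r x _ hx =>
        intro a
        rw [smul_eq_mul, ← mul_assoc]
        exact hx _
    have h2 := h1 1 (hS ▸ trivial) 1
    rwa [mul_one, hΛ.average_one_one, mul_one] at h2
  · exfalso
    obtain ⟨u, hu⟩ := exists_forall_eval_eq_zero hS
    have hu' : ∀ b ∈ S, eval u b = 0 := fun b hb => hu b (Ideal.subset_span hb)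
    by_cases hI : vanishingIdeal ℂ n Y ⊔ orbIdeal Γ u = ⊤
    · obtain ⟨a, ha, b, hb, hab⟩ := Submodule.mem_sup.1 ((Ideal.eq_top_iff_one _).1 hI)
      have h1 := hu' _ ⟨hΛ.eval_act_average_one a, J.mul_mem_left _ (hRJ a ha)⟩
      have h2 : (fun g : Γ => (1 : Γ → ℂ) g * eval (act g u) a) = 1 := by
        ext g
        have := congrArg (eval (act g u)) hab
        rw [map_add, mem_orbIdeal.1 hb g, add_zero, map_one] at this
        simp [this]
      rw [eval_average, h2, hΛ.one] at h1
      exact one_ne_zero h1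
    · obtain ⟨y, hy⟩ := exists_forall_eval_eq_zero hI
      have hyY : y ∈ Y := by
        obtain ⟨P, rfl⟩ := hYa
        exact fun p hp => hy p (Ideal.mem_sup_left fun x hx => hx p hp)
      obtain ⟨g, hg, hd⟩ := hY y hyY
      obtain ⟨b, hb, hb1, hbJ⟩ := exists_invariant_mul_mem hΛ hN hg hd f
      have h1 := hu' b ⟨hb, hbJ J fun p => hRJ _ (Ideal.mul_mem_right _ _ hf)⟩
      have h2 := hy b (Ideal.mem_sup_right (mem_orbIdeal.2 fun g => by rw [hb, h1]))
      rw [hb, h2] at hb1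
      exact zero_ne_one hb1

end

section

/-- The differential of the polynomial `p` at `x`, applied to `w`. -/
def dEval {σ : Type*} [Fintype σ] (p : MvPolynomial σ ℂ) (x w : σ → ℂ) : ℂ :=
  ∑ i, eval x (pderiv i p) * w i

theorem hasDerivAt_eval {σ : Type*} [Fintype σ] (p : MvPolynomial σ ℂ) {x : ℂ → σ → ℂ}
    {w : σ → ℂ} {t : ℂ} (hx : ∀ i, HasDerivAt (fun s => x s i) (w i) t) :
    HasDerivAt (fun s => eval (x s) p) (dEval p (x t) w) t := by
  classical
  induction p using MvPolynomial.induction_on with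
  | C a =>
    simp only [dEval, eval_C, pderiv_C, map_zero, zero_mul, Finset.sum_const_zero]
    exact hasDerivAt_const t a
  | add p q hp hq =>
    simp only [dEval, map_add, add_mul, Finset.sum_add_distrib] at hp hq ⊢
    exact hp.add hq
  | mul_X p i hp =>
    simp only [dEval, map_mul, eval_X] at hp ⊢
    refine (hp.mul (hx i)).congr_deriv ?_
    simp only [Derivation.leibniz, pderiv_X, smul_eq_mul, map_add, map_mul, eval_X, add_mul,
      Finset.sum_add_distrib, Pi.single_apply]
    rw [add_comm, Finset.sum_mul]
    congr 1
    · rw [Finset.sum_eq_single i] <;> simp +contextual [eq_comm]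
    · exact Finset.sum_congr rfl fun j _ => by ring

theorem dEval_eq_of_eval_eq {σ τ : Type*} [Fintype σ] [Fintype τ] {p : MvPolynomial σ ℂ}
    {q : MvPolynomial τ ℂ} (F : (σ → ℂ) →ₗ[ℂ] (τ → ℂ))
    (h : ∀ x, eval x p = eval (F x) q) (x w : σ → ℂ) : dEval p x w = dEval q (F x) (F w) := by
  have h1 : HasDerivAt (fun s : ℂ => eval (x + s • w) p) (dEval p x w) 0 := by
    have := hasDerivAt_eval p (x := fun s : ℂ => x + s • w) (w := w) (t := 0) fun i => by
      simpa using ((hasDerivAt_id (0 : ℂ)).mul_const (w i)).const_add (x i)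
    simpa using this
  have h2 : HasDerivAt (fun s : ℂ => eval (F x + s • F w) q) (dEval q (F x) (F w)) 0 := by
    have := hasDerivAt_eval q (x := fun s : ℂ => F x + s • F w) (w := F w) (t := 0) fun i => by
      simpa using ((hasDerivAt_id (0 : ℂ)).mul_const (F w i)).const_add (F x i)
    simpa using this
  refine h1.unique ?_
  simpa [h] using h2

variable {n : ℕ}

/-- The entries of a matrix as a point of affine space. -/
def entries : Matrix (Fin n) (Fin n) ℂ →ₗ[ℂ] (Fin n × Fin n → ℂ) where
  toFun A ij := A ij.1 ij.2
  map_add' _ _ := rfl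
  map_smul' _ _ := rfl

theorem entries_apply (A : Matrix (Fin n) (Fin n) ℂ) (ij : Fin n × Fin n) :
    entries A ij = A ij.1 ij.2 := rfl

/-- Left multiplication on the coordinates of matrix space. -/
def entriesMul (g : Matrix (Fin n) (Fin n) ℂ) : (Fin n × Fin n → ℂ) →ₗ[ℂ] (Fin n × Fin n → ℂ) where
  toFun x ij := ∑ k, g ij.1 k * x (k, ij.2)
  map_add' _ _ := by ext; simp [mul_add, Finset.sum_add_distrib]
  map_smul' _ _ := by ext; simp [Finset.mul_sum, mul_left_comm]

theorem entriesMul_entries (g A : Matrix (Fin n) (Fin n) ℂ) :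
    entriesMul g (entries A) = entries (g * A) := by
  ext ij
  simp [entriesMul, entries_apply, Matrix.mul_apply]

/-- Left translation of polynomials on matrix space. -/
def leftTranslate (g : Matrix (Fin n) (Fin n) ℂ) (P : MvPolynomial (Fin n × Fin n) ℂ) :
    MvPolynomial (Fin n × Fin n) ℂ :=
  MvPolynomial.aeval (fun ij : Fin n × Fin n => ∑ k, C (g ij.1 k) * X (k, ij.2)) P

theorem eval_leftTranslate (g : Matrix (Fin n) (Fin n) ℂ) (P : MvPolynomial (Fin n × Fin n) ℂ)
    (x : Fin n × Fin n → ℂ) : eval x (leftTranslate g P) = eval (entriesMul g x) P := by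
  have : (MvPolynomial.aeval x).comp
      (MvPolynomial.aeval (fun ij : Fin n × Fin n => ∑ k, C (g ij.1 k) * X (k, ij.2)))
      = (MvPolynomial.aeval (entriesMul g x) : MvPolynomial (Fin n × Fin n) ℂ →ₐ[ℂ] ℂ) :=
    MvPolynomial.algHom_ext (by simp [entriesMul])
  have := DFunLike.congr_fun this P
  simpa [MvPolynomial.aeval_eq_eval, leftTranslate] using this

/-- `P` vanishes on `G`. -/
def VanishesOn (G : Set (Matrix (Fin n) (Fin n) ℂ)) (P : MvPolynomial (Fin n × Fin n) ℂ) : Prop :=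
  ∀ g ∈ G, eval (entries g) P = 0

theorem VanishesOn.leftTranslate {G : Set (Matrix (Fin n) (Fin n) ℂ)} (hG : IsMatSubgroup ℂ n G)
    {P : MvPolynomial (Fin n × Fin n) ℂ} (hP : VanishesOn G P) {g : Matrix (Fin n) (Fin n) ℂ}
    (hg : g ∈ G) : VanishesOn G (leftTranslate g P) := fun h hh => by
  rw [eval_leftTranslate, entriesMul_entries]
  exact hP _ (hG.2.1 _ hg _ hh)

/-- The Zariski tangent space of `G` at `g`. -/
def zariskiTangent (G : Set (Matrix (Fin n) (Fin n) ℂ)) (g : Matrix (Fin n) (Fin n) ℂ) :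
    Submodule ℂ (Matrix (Fin n) (Fin n) ℂ) where
  carrier := {A | ∀ P, VanishesOn G P → dEval P (entries g) (entries A) = 0}
  zero_mem' := fun P _ => by simp [dEval]
  add_mem' := fun {A B} ha hb P hP => by
    have h1 := ha P hP
    have h2 := hb P hP
    simp only [dEval, map_add, Pi.add_apply, mul_add, Finset.sum_add_distrib] at h1 h2 ⊢
    rw [h1, h2, add_zero]
  smul_mem' := fun c A ha P hP => by
    have h1 := ha P hP
    simp only [dEval, map_smul, Pi.smul_apply, smul_eq_mul, mul_left_comm,
      ← Finset.mul_sum] at h1 ⊢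
    rw [h1, mul_zero]

theorem mul_mem_zariskiTangent {G : Set (Matrix (Fin n) (Fin n) ℂ)} (hG : IsMatSubgroup ℂ n G)
    {g h A : Matrix (Fin n) (Fin n) ℂ} (hg : g ∈ G) (hA : A ∈ zariskiTangent G h) :
    g * A ∈ zariskiTangent G (g * h) := fun P hP => by
  rw [← entriesMul_entries, ← entriesMul_entries,
    ← dEval_eq_of_eval_eq (entriesMul g) (eval_leftTranslate g P)]
  exact hA _ (hP.leftTranslate hG hg)

theorem mexp_eq (A : Matrix (Fin n) (Fin n) ℂ) : mexp ℂ n A = NormedSpace.exp A := by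
  open Matrix.Norms.Operator in
  rw [NormedSpace.exp_eq_tsum ℂ]
  rfl

theorem hasDerivAt_mexp (A : Matrix (Fin n) (Fin n) ℂ) (t : ℂ) (ij : Fin n × Fin n) :
    HasDerivAt (fun s : ℂ => entries (mexp ℂ n (s • A)) ij)
      (entries (mexp ℂ n (t • A) * A) ij) t := by
  simp only [mexp_eq]
  have : HasDerivAt (fun s : ℂ => NormedSpace.exp (s • A)) (NormedSpace.exp (t • A) * A) t := by
    open Matrix.Norms.Operator in
    exact hasDerivAt_exp_smul_const A t
  exact hasDerivAt_pi.1 (hasDerivAt_pi.1 this ij.1) ij.2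

theorem lieAlgebra_eq {G : Set (Matrix (Fin n) (Fin n) ℂ)} (hG : IsMatSubgroup ℂ n G)
    (hz : IsZClosedInGL ℂ n G) : lieAlgebra ℂ n G = zariskiTangent G 1 := by
  have hexp0 : ∀ A : Matrix (Fin n) (Fin n) ℂ, mexp ℂ n ((0 : ℂ) • A) = 1 := fun A => by
    rw [mexp_eq, zero_smul, NormedSpace.exp_zero]
  ext A
  constructor
  · intro hA
    refine fun P (hP : VanishesOn G P) => ?_
    have hA' : ∀ t : ℂ, mexp ℂ n (t • A) ∈ G := hA
    have h1 := hasDerivAt_eval P (x := fun s : ℂ => entries (mexp ℂ n (s • A)))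
      (hasDerivAt_mexp A 0)
    simp only [hexp0, one_mul] at h1
    refine h1.unique ?_
    have h0 : ∀ s : ℂ, eval (entries (mexp ℂ n (s • A))) P = 0 := by
      intro s
      apply hP
      exact hA' s
    have : (fun s : ℂ => eval (entries (mexp ℂ n (s • A))) P) = fun _ => 0 := funext h0
    rw [this]
    exact hasDerivAt_const (0 : ℂ) (0 : ℂ)
  · intro hA
    let E : MvPolynomial (Fin n × Fin n) ℂ → MvPolynomial (Fin n × Fin n) ℂ := fun P =>
      ∑ ij : Fin n × Fin n, pderiv ij P * ∑ k, X (ij.1, k) * C (A k ij.2)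
    have hE : ∀ P g, eval (entries g) (E P) = dEval P (entries g) (entries (g * A)) := by
      intro P g
      simp [E, dEval, entries_apply, Matrix.mul_apply]
    have hEG : ∀ P, VanishesOn G P → VanishesOn G (E P) := by
      intro P hP g hg
      rw [hE]
      have := mul_mem_zariskiTangent hG hg hA P hP
      rwa [mul_one] at this
    have hder : ∀ P t, HasDerivAt (fun s : ℂ => eval (entries (mexp ℂ n (s • A))) P)
        (eval (entries (mexp ℂ n (t • A))) (E P)) t := fun P t => by
      rw [hE]
      exact hasDerivAt_eval P (x := fun s : ℂ => entries (mexp ℂ n (s • A))) (hasDerivAt_mexp A t)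
    have hiter : ∀ k P, VanishesOn G P →
        iteratedDeriv k (fun s : ℂ => eval (entries (mexp ℂ n (s • A))) P) 0 = 0 := by
      intro k
      induction k with
      | zero =>
        intro P hP
        rw [iteratedDeriv_zero, hexp0]
        exact hP 1 hG.1
      | succ k ih =>
        intro P hP
        rw [iteratedDeriv_succ', funext fun t => (hder P t).deriv]
        exact ih _ (hEG P hP)
    obtain ⟨S, rfl⟩ := hz
    intro t
    refine ⟨by rw [mexp_eq]; exact Matrix.isUnit_exp _, fun P hP => ?_⟩
    have h1 := Complex.taylorSeries_eq_of_entire (c := 0) (z := t)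
      (fun t => (hder P t).differentiableAt)
    simp only [hiter _ P (fun g hg => hg.2 P hP), smul_zero, tsum_zero] at h1
    exact h1.symm

theorem orbitTangent_eq {G : Set (Matrix (Fin n) (Fin n) ℂ)} (hG : IsMatSubgroup ℂ n G)
    (hz : IsZClosedInGL ℂ n G) {v w : Fin n → ℂ} (hw : w ∈ orbitTangent ℂ n G v) :
    ∃ A ∈ zariskiTangent G 1, A.mulVec v = w := by
  have hle : orbitTangent ℂ n G v ≤
      (zariskiTangent G 1).map ((Matrix.mulVecBilin ℂ ℂ).flip v) := by
    rw [orbitTangent, Submodule.span_le, lieAlgebra_eq hG hz]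
    rintro _ ⟨A, hA, rfl⟩
    exact ⟨A, hA, by simp⟩
  obtain ⟨A, hA, h⟩ := hle hw
  exact ⟨A, hA, by simpa using h⟩

end

section

open Topology

variable {n : ℕ}

theorem eq_zero_of_eventually_eval_eq_zero {p : MvPolynomial (Fin n) ℂ} {y : Fin n → ℂ}
    (h : ∀ᶠ x in 𝓝 y, eval x p = 0) : p = 0 := by
  obtain ⟨ε, hε, hb⟩ := Metric.eventually_nhds_iff_ball.1 h
  refine MvPolynomial.funext_set (fun i => Metric.ball (y i) ε) (fun i => ?_) fun x hx => ?_
  · exact infinite_of_mem_nhds (y i) (Metric.ball_mem_nhds _ hε)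
  · rw [map_zero]
    refine hb x ?_
    rw [ball_pi _ hε]
    exact hx

theorem eventually_exists_exp_apply_eq {𝔸 E : Type*} [NormedRing 𝔸] [NormedAlgebra ℂ 𝔸]
    [FiniteDimensional ℂ 𝔸] [NormedAddCommGroup E] [NormedSpace ℂ E] [FiniteDimensional ℂ E]
    (β : 𝔸 →L[ℂ] E →L[ℂ] E) (hβ : ∀ x, β 1 x = x) (T : Submodule ℂ 𝔸) (N : Submodule ℂ E) (y : E)
    (h : ∀ w, ∃ A ∈ T, ∃ ν ∈ N, β A y + ν = w) :
    ∀ᶠ x in 𝓝 y, ∃ A ∈ T, ∃ ν ∈ N, β (NormedSpace.exp A) (y + ν) = x := by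
  have : CompleteSpace 𝔸 := FiniteDimensional.complete ℂ 𝔸
  have : CompleteSpace E := FiniteDimensional.complete ℂ E
  have : CompleteSpace T := FiniteDimensional.complete ℂ T
  have : CompleteSpace N := FiniteDimensional.complete ℂ N
  have h1 : HasStrictFDerivAt (fun q : T × N => NormedSpace.exp q.1.1)
      (T.subtypeL ∘L ContinuousLinearMap.fst ℂ T N) 0 := by
    have h0 : HasStrictFDerivAt (NormedSpace.exp : 𝔸 → 𝔸) (1 : 𝔸 →L[ℂ] 𝔸)
        ((T.subtypeL ∘L ContinuousLinearMap.fst ℂ T N) 0) := by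
      rw [map_zero]
      exact hasStrictFDerivAt_exp_zero
    exact h0.comp 0 (ContinuousLinearMap.hasStrictFDerivAt _)
  have h2 : HasStrictFDerivAt (fun q : T × N => y + q.2.1)
      (N.subtypeL ∘L ContinuousLinearMap.snd ℂ T N) 0 :=
    (ContinuousLinearMap.hasStrictFDerivAt
      (N.subtypeL ∘L ContinuousLinearMap.snd ℂ T N)).const_add y
  have h4 := (ContinuousLinearMap.hasStrictFDerivAt_of_bilinear β h1 h2).map_nhds_eq_of_surj (by
    rw [Submodule.eq_top_iff']
    intro w
    obtain ⟨A, hA, ν, hν, rfl⟩ := h w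
    refine ⟨(⟨A, hA⟩, ⟨ν, hν⟩), ?_⟩
    simp [hβ, add_comm])
  have hy : β (NormedSpace.exp (0 : T × N).1.1) (y + (0 : T × N).2.1) = y := by
    simp [hβ]
  rw [hy] at h4
  rw [← h4, Filter.eventually_map]
  exact Filter.Eventually.of_forall fun q => ⟨_, q.1.2, _, q.2.2, rfl⟩

theorem eq_zero_of_forall_eval_slice {G : Set (Matrix (Fin n) (Fin n) ℂ)} (hG : IsMatSubgroup ℂ n G)
    (hz : IsZClosedInGL ℂ n G) {y : Fin n → ℂ} {N : Submodule ℂ (Fin n → ℂ)}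
    (hN : Codisjoint (orbitTangent ℂ n G y) N) {p : MvPolynomial (Fin n) ℂ}
    (hp : ∀ g ∈ G, ∀ ν ∈ N, eval (g.mulVec (y + ν)) p = 0) : p = 0 := by
  open Matrix.Norms.Operator in
  let β : Matrix (Fin n) (Fin n) ℂ →L[ℂ] (Fin n → ℂ) →L[ℂ] (Fin n → ℂ) :=
    LinearMap.toContinuousLinearMap
      (LinearMap.toContinuousLinearMap.toLinearMap ∘ₗ Matrix.mulVecBilin ℂ ℂ)
  have hβ : ∀ A x, β A x = A.mulVec x := fun A x => by simp [β]
  have h := eventually_exists_exp_apply_eq β (fun x => (hβ 1 x).trans (Matrix.one_mulVec x))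
    (zariskiTangent G 1) N y fun w => by
      have hw : w ∈ orbitTangent ℂ n G y ⊔ N := hN.eq_top.symm ▸ Submodule.mem_top
      obtain ⟨w', hw', ν, hν, hww⟩ := Submodule.mem_sup.1 hw
      obtain ⟨A, hA, hAw⟩ := orbitTangent_eq hG hz hw'
      exact ⟨A, hA, ν, hν, by rw [← hww, ← hAw]; exact congrArg (· + ν) (hβ A y)⟩
  refine eq_zero_of_eventually_eval_eq_zero (y := y) (h.mono ?_)
  rintro x ⟨A, hA, ν, hν, hx⟩
  rw [← hx]
  have h5 : A ∈ lieAlgebra ℂ n G := by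
    rw [lieAlgebra_eq hG hz]
    exact hA
  have h6 : ∀ t : ℂ, mexp ℂ n (t • A) ∈ G := h5
  have h7 := h6 1
  rw [one_smul, mexp_eq] at h7
  exact (congrArg (fun z => eval z p) (hβ _ _)).trans (hp _ h7 ν hν)

end

section

theorem exists_mul_derivation_mem_range {B L : Type*} [CommRing B] [IsDomain B] [Field L]
    [Algebra B L] [IsFractionRing B L] [Algebra ℂ B] [Algebra ℂ L] [IsScalarTower ℂ B L]
    [Algebra.FiniteType ℂ B] (δ : Derivation ℂ L L) :
    ∃ h : B, h ≠ 0 ∧ ∀ b : B, ∃ c : B, algebraMap B L c =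
      algebraMap B L h * δ (algebraMap B L b) := by
  classical
  obtain ⟨s, hs⟩ := Algebra.FiniteType.out (R := ℂ) (A := B)
  obtain ⟨h, hh⟩ := IsLocalization.exist_integer_multiples_of_finset (nonZeroDivisors B)
    (s.image fun b => δ (algebraMap B L b))
  refine ⟨h, nonZeroDivisors.ne_zero h.2, fun b => ?_⟩
  have hb : b ∈ Algebra.adjoin ℂ (s : Set B) := hs ▸ Algebra.mem_top
  induction hb using Algebra.adjoin_induction with
  | mem b hb =>
    obtain ⟨c, hc⟩ := hh _ (Finset.mem_image_of_mem _ hb)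
    exact ⟨c, by rw [hc, Algebra.smul_def]⟩
  | algebraMap r =>
    refine ⟨0, ?_⟩
    rw [← IsScalarTower.algebraMap_apply ℂ B L, Derivation.map_algebraMap]
    simp
  | add x y _ _ hx hy =>
    obtain ⟨c, hc⟩ := hx
    obtain ⟨d, hd⟩ := hy
    exact ⟨c + d, by simp [hc, hd, mul_add]⟩
  | mul x y _ _ hx hy =>
    obtain ⟨c, hc⟩ := hx
    obtain ⟨d, hd⟩ := hy
    refine ⟨x * d + y * c, ?_⟩
    simp only [map_add, map_mul, Derivation.leibniz, smul_eq_mul, hc, hd]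
    ring

theorem exists_tangent_of_derivation {A B : Type*} [CommRing A] [CommRing B] [Algebra ℂ A]
    [Algebra ℂ B] [Algebra A B] [IsScalarTower ℂ A B] [Algebra.FiniteType ℂ B] [IsReduced B]
    [Nontrivial B] (hAB : Function.Injective (algebraMap A B)) (D : Derivation ℂ A B) :
    ∃ χ : B →ₐ[ℂ] ℂ, ∃ ξ : B →ₗ[ℂ] ℂ, (∀ b c, ξ (b * c) = χ b * ξ c + χ c * ξ b) ∧
      ∀ a, ξ (algebraMap A B a) = χ (D a) := by
  have : IsReduced A := isReduced_of_injective _ hAB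
  have : Nontrivial A := (algebraMap A B).domain_nontrivial
  let _ : Algebra ℚ A := Algebra.compHom A (algebraMap ℚ ℂ)
  obtain ⟨q, hq⟩ := Ideal.nonempty_minimalPrimes (bot_ne_top (α := Ideal A))
  obtain ⟨𝔭, hp, hpq⟩ := Ideal.exists_comap_eq_of_mem_minimalPrimes_of_injective hAB q hq
  let L := FractionRing (B ⧸ 𝔭)
  have hker : RingHom.ker (algebraMap A L) = q := by
    rw [← hpq]
    ext a
    rw [RingHom.mem_ker, Ideal.mem_comap, IsScalarTower.algebraMap_apply A (B ⧸ 𝔭) L,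
      FaithfulSMul.algebraMap_eq_zero_iff, IsScalarTower.algebraMap_apply A B (B ⧸ 𝔭),
      Ideal.Quotient.algebraMap_eq, Ideal.Quotient.eq_zero_iff_mem]
  have : Algebra.EssFiniteType A L := by
    have : Algebra.EssFiniteType ℂ L := Algebra.EssFiniteType.comp ℂ (B ⧸ 𝔭) L
    exact Algebra.EssFiniteType.of_comp ℂ A L
  have := formallySmooth_of_mem_minimalPrimes (A := A) (L := L) (by rw [hker]; exact hq)
  let D' : Derivation ℂ A L := (IsScalarTower.toAlgHom A B L).toLinearMap.compDer D
  obtain ⟨δ, hδ⟩ := exists_derivation_extension (k := ℂ) (A := A) (L := L) D'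
  obtain ⟨h, hh, hc⟩ := exists_mul_derivation_mem_range (B := B ⧸ 𝔭) δ
  obtain ⟨χ, -, hχ⟩ := exists_algHom_ne_zero_of_notMem (B := B ⧸ 𝔭) ⊥
    Ideal.isPrime_bot.isRadical (b := h) (by simpa using hh)
  choose c hc using hc
  have hinj : Function.Injective (algebraMap (B ⧸ 𝔭) L) := FaithfulSMul.algebraMap_injective _ _
  have hcadd : ∀ x y, c (x + y) = c x + c y := fun x y => hinj (by
    rw [hc, map_add, map_add, map_add, hc, hc, mul_add])
  have algebraMap_smul_eq : ∀ (r : ℂ) (x : B ⧸ 𝔭),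
      algebraMap (B ⧸ 𝔭) L (r • x) = r • algebraMap (B ⧸ 𝔭) L x := fun r x =>
    (IsScalarTower.toAlgHom ℂ (B ⧸ 𝔭) L).toLinearMap.map_smul r x
  have hcsmul : ∀ (r : ℂ) x, c (r • x) = r • c x := fun r x => hinj (by
    rw [hc, algebraMap_smul_eq, algebraMap_smul_eq, δ.map_smul, hc, mul_smul_comm])
  have hcmul : ∀ x y, c (x * y) = x * c y + y * c x := fun x y => hinj (by
    rw [hc, map_add, (algebraMap (B ⧸ 𝔭) L).map_mul x y, δ.leibniz, smul_eq_mul,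
      smul_eq_mul, map_mul, map_mul, hc, hc]
    ring)
  let mk := Ideal.Quotient.mkₐ ℂ 𝔭
  refine ⟨χ.comp mk,
    { toFun := fun b => (χ h)⁻¹ * χ (c (mk b))
      map_add' := fun b b' => by simp [hcadd, mul_add]
      map_smul' := fun r b => by simp [hcsmul]; ring }, fun b b' => ?_, fun a => ?_⟩
  · simp only [LinearMap.coe_mk, AddHom.coe_mk, AlgHom.comp_apply, map_mul, map_add, hcmul]
    ring
  · have h1 : c (mk (algebraMap A B a)) = h * mk (D a) := hinj (by
      rw [hc, map_mul]
      congr 1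
      exact hδ a)
    simp only [LinearMap.coe_mk, AddHom.coe_mk, AlgHom.comp_apply, h1, map_mul]
    field_simp

end

section

theorem exists_tangent_of_algHom {P B : Type*} [CommRing P] [CommRing B] [Algebra ℂ P]
    [Algebra ℂ B] [Algebra.FiniteType ℂ B] [IsReduced B] [Nontrivial B] (φ : P →ₐ[ℂ] B)
    (D : P →ₗ[ℂ] B) (hD : ∀ p q, D (p * q) = φ p * D q + φ q * D p)
    (hker : ∀ p, φ p = 0 → D p = 0) :
    ∃ χ : B →ₐ[ℂ] ℂ, ∃ ξ : B →ₗ[ℂ] ℂ, (∀ b c, ξ (b * c) = χ b * ξ c + χ c * ξ b) ∧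
      ∀ p, ξ (φ p) = χ (D p) := by
  choose s hs using fun a : φ.range => a.2
  have hs' : ∀ a, φ (s a) = a := hs
  have hwd : ∀ p q, φ p = φ q → D p = D q := fun p q h => by
    have := hker (p - q) (by rw [map_sub, h, sub_self])
    rwa [map_sub, sub_eq_zero] at this
  let D₁ : φ.range →ₗ[ℂ] B :=
    { toFun := fun a => D (s a)
      map_add' := fun a b => by
        rw [← map_add]
        exact hwd _ _ (by simp [hs'])
      map_smul' := fun r a => by
        rw [RingHom.id_apply, ← map_smul]
        exact hwd _ _ (by simp [hs']) }
  let D₂ : Derivation ℂ φ.range B := Derivation.mk' D₁ fun a b => by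
    have : D₁ (a * b) = D (s a * s b) := hwd _ _ (by simp [hs'])
    rw [this, hD, hs', hs']
    rfl
  obtain ⟨χ, ξ, h1, h2⟩ := exists_tangent_of_derivation (A := φ.range) (B := B)
    Subtype.val_injective D₂
  refine ⟨χ, ξ, h1, fun p => ?_⟩
  have := h2 ⟨φ p, p, rfl⟩
  have h3 : D₂ ⟨φ p, p, rfl⟩ = D p := hwd _ _ (hs' _)
  rw [h3] at this
  exact this

section dEval
variable {σ : Type*} [Fintype σ]

theorem dEval_add_left (p q : MvPolynomial σ ℂ) (x w : σ → ℂ) :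
    dEval (p + q) x w = dEval p x w + dEval q x w := by
  simp [dEval, add_mul, Finset.sum_add_distrib]

theorem dEval_smul_left (c : ℂ) (p : MvPolynomial σ ℂ) (x w : σ → ℂ) :
    dEval (c • p) x w = c * dEval p x w := by
  simp [dEval, Finset.mul_sum, mul_assoc, smul_eval]

theorem dEval_mul_left (p q : MvPolynomial σ ℂ) (x w : σ → ℂ) :
    dEval (p * q) x w = eval x p * dEval q x w + eval x q * dEval p x w := by
  simp only [dEval, Finset.mul_sum, ← Finset.sum_add_distrib]
  refine Finset.sum_congr rfl fun i _ => ?_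
  simp only [Derivation.leibniz, smul_eq_mul, map_add, map_mul]
  ring

@[simp] theorem dEval_C (a : ℂ) (x w : σ → ℂ) : dEval (C a) x w = 0 := by
  simp [dEval]

@[simp] theorem dEval_X (i : σ) (x w : σ → ℂ) : dEval (X i) x w = w i := by
  classical
  rw [dEval, Finset.sum_eq_single i]
  · simp [pderiv_X]
  · intro j _ hj
    simp [pderiv_X, hj.symm]
  · simp

theorem pointDerivation_aeval {B : Type*} [CommRing B] [Algebra ℂ B] (χ : B →ₐ[ℂ] ℂ)
    (ξ : B →ₗ[ℂ] ℂ) (hξ : ∀ b c, ξ (b * c) = χ b * ξ c + χ c * ξ b) (e : σ → B)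
    (p : MvPolynomial σ ℂ) :
    ξ (MvPolynomial.aeval e p) = dEval p (fun i => χ (e i)) fun i => ξ (e i) := by
  have h1 : ξ 1 = 0 := by
    have := hξ 1 1
    simpa using this
  have heval : ∀ p : MvPolynomial σ ℂ, χ (MvPolynomial.aeval e p) = eval (fun i => χ (e i)) p := by
    intro p
    rw [← MvPolynomial.aeval_eq_eval, MvPolynomial.comp_aeval_apply]
  induction p using MvPolynomial.induction_on with
  | C a =>
    rw [dEval_C, MvPolynomial.aeval_C, Algebra.algebraMap_eq_smul_one, map_smul, h1, smul_zero]
  | add p q hp hq => rw [map_add, map_add, hp, hq, dEval_add_left]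
  | mul_X p i hp =>
    rw [map_mul, hξ, hp, dEval_mul_left, heval, MvPolynomial.aeval_X, dEval_X, eval_X]

end dEval

variable {n : ℕ}

theorem dEval_translate (A : Matrix (Fin n) (Fin n) ℂ) (p : MvPolynomial (Fin n) ℂ)
    (x w : Fin n → ℂ) :
    dEval (translate A p) x w = dEval p (A.mulVec x) (A.mulVec w) :=
  dEval_eq_of_eval_eq (Matrix.mulVecLin A) (fun x => eval_translate A p x) x w

section
variable {Γ : Subgroup (GL (Fin n) ℂ)}

theorem translate_mem_orbIdeal {v : Fin n → ℂ} {p : MvPolynomial (Fin n) ℂ}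
    (hp : p ∈ orbIdeal Γ v) (g : Γ) : translate g.1.1 p ∈ orbIdeal Γ v :=
  mem_orbIdeal.2 fun h => by
    rw [eval_translate_act, ← act_mul]
    exact mem_orbIdeal.1 hp _

/-- The derivative of the restriction of polynomials to an orbit along an equivariant field. -/
def orbDeriv (Γ : Subgroup (GL (Fin n) ℂ)) (v w : Fin n → ℂ) :
    MvPolynomial (Fin n) ℂ →ₗ[ℂ] reg Γ where
  toFun p := ⟨fun g => dEval p (act g v) (act g w), by
    have : (fun g : Γ => dEval p (act g v) (act g w)) = ∑ i,
        (fun g : Γ => eval (act g v) (pderiv i p)) * fun g : Γ => eval (act g w) (X i) := by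
      ext g
      simp [dEval]
    rw [this]
    exact sum_mem fun i _ => mul_mem (orb_mem_reg _ _) (orb_mem_reg _ _)⟩
  map_add' p q := Subtype.ext (funext fun g => dEval_add_left p q _ _)
  map_smul' c p := Subtype.ext (funext fun g => dEval_smul_left c p _ _)

theorem orbDeriv_apply (v w : Fin n → ℂ) (p : MvPolynomial (Fin n) ℂ) (g : Γ) :
    (orbDeriv Γ v w p).1 g = dEval p (act g v) (act g w) := rfl

end

theorem mem_orbitTangent {G : Set (Matrix (Fin n) (Fin n) ℂ)} (hG : IsMatSubgroup ℂ n G)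
    (hz : IsZClosedInGL ℂ n G) {v w : Fin n → ℂ}
    (hw : ∀ p ∈ orbIdeal (glSubgroup G hG) v, dEval p v w = 0) : w ∈ orbitTangent ℂ n G v := by
  let Γ := glSubgroup G hG
  obtain ⟨χ, ξ, h1, h2⟩ := exists_tangent_of_algHom (orbMap Γ v) (orbDeriv Γ v w)
    (fun p q => Subtype.ext (funext fun g => by
      rw [orbDeriv_apply, dEval_mul_left, ← orbMap_apply, ← orbMap_apply]
      rfl))
    (fun p hp => Subtype.ext (funext fun g => by
      have hp' : p ∈ orbIdeal Γ v := mem_orbIdeal.2 fun g => by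
        rw [← orbMap_apply, hp]
        rfl
      have := hw _ (translate_mem_orbIdeal hp' g)
      rw [dEval_translate] at this
      exact this))
  obtain ⟨g, hg⟩ := isAffineGroup_glSubgroup hG hz χ
  let e : Fin n × Fin n → reg Γ := fun ij => ⟨_, entry_mem_reg ij.1 ij.2⟩
  let A : Matrix (Fin n) (Fin n) ℂ := Matrix.of fun i j => ξ (e (i, j))
  have hχe : (fun ij => χ (e ij)) = entries g.1.1 := funext fun ij => hg _
  have hA : A ∈ zariskiTangent G g.1.1 := fun P hP => by
    have h3 : MvPolynomial.aeval e P = 0 := by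
      refine Subtype.ext (funext fun h => ?_)
      have h4 : (MvPolynomial.aeval e P).1 h = eval (entries h.1.1) P := by
        have : ((Pi.evalAlgHom ℂ (fun _ => ℂ) h).comp (reg Γ).val).comp (MvPolynomial.aeval e)
            = MvPolynomial.aeval (entries h.1.1) :=
          MvPolynomial.algHom_ext fun i => by simp [e, entries_apply]
        have := DFunLike.congr_fun this P
        simpa [MvPolynomial.aeval_eq_eval] using this
      rw [h4]
      exact hP _ h.2
    have h5 := pointDerivation_aeval χ ξ h1 e P
    rw [h3, map_zero, hχe] at h5
    exact h5.symm
  have hAv : A.mulVec v = g.1.1.mulVec w := by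
    ext i
    have h3 : orbMap Γ v (X i) = ∑ j, v j • e (i, j) := by
      refine Subtype.ext (funext fun h => ?_)
      rw [orbMap_apply]
      simp [act, Matrix.mulVec, dotProduct, e, mul_comm]
    have h4 := h2 (X i)
    rw [h3, hg, orbDeriv_apply, dEval_X, map_sum] at h4
    simp only [map_smul, smul_eq_mul] at h4
    simp only [Matrix.mulVec, dotProduct, A, Matrix.of_apply]
    rw [show ∑ j, ξ (e (i, j)) * v j = ∑ j, v j * ξ (e (i, j)) from
      Finset.sum_congr rfl fun j _ => mul_comm _ _, h4]
    rfl
  have hinv : g⁻¹.1.1 * g.1.1 = 1 := by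
    have : (g⁻¹ * g).1.1 = 1 := by simp
    exact this
  have h3 := mul_mem_zariskiTangent hG (g := g⁻¹.1.1) g⁻¹.2 hA
  rw [hinv] at h3
  refine Submodule.subset_span ⟨g⁻¹.1.1 * A, ?_, ?_⟩
  · rw [lieAlgebra_eq hG hz]
    exact h3
  · simp only
    rw [← Matrix.mulVec_mulVec, hAv, Matrix.mulVec_mulVec, hinv, Matrix.one_mulVec]

theorem dEval_eq_zero_of_mem_orbitTangent {G : Set (Matrix (Fin n) (Fin n) ℂ)}
    (hG : IsMatSubgroup ℂ n G) (hz : IsZClosedInGL ℂ n G) {v w : Fin n → ℂ}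
    (hw : w ∈ orbitTangent ℂ n G v) {p : MvPolynomial (Fin n) ℂ}
    (hp : p ∈ orbIdeal (glSubgroup G hG) v) : dEval p v w = 0 := by
  obtain ⟨A, hA, rfl⟩ := orbitTangent_eq hG hz hw
  let F : (Fin n × Fin n → ℂ) →ₗ[ℂ] (Fin n → ℂ) :=
    { toFun := fun x i => ∑ j, x (i, j) * v j
      map_add' := fun x y => by ext; simp [add_mul, Finset.sum_add_distrib]
      map_smul' := fun c x => by ext; simp [Finset.mul_sum, mul_assoc] }
  have hF : ∀ B, F (entries B) = B.mulVec v := fun B => rfl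
  let P : MvPolynomial (Fin n × Fin n) ℂ :=
    MvPolynomial.aeval (fun i => ∑ j, X (i, j) * C (v j)) p
  have hP : ∀ x, eval x P = eval (F x) p := fun x => by
    have : (MvPolynomial.aeval x).comp (MvPolynomial.aeval
          (fun i => ∑ j, X (i, j) * C (v j) : Fin n → MvPolynomial (Fin n × Fin n) ℂ))
        = (MvPolynomial.aeval (F x) : MvPolynomial (Fin n) ℂ →ₐ[ℂ] ℂ) :=
      MvPolynomial.algHom_ext (by simp [F])
    have := DFunLike.congr_fun this p
    simpa [MvPolynomial.aeval_eq_eval, P] using this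
  have h1 := dEval_eq_of_eval_eq F hP (entries 1) (entries A)
  rw [hF, hF, Matrix.one_mulVec] at h1
  rw [← h1]
  refine hA P fun g hg => ?_
  rw [hP, hF]
  obtain ⟨h, rfl⟩ := exists_mem_glSubgroup hG hg
  exact mem_orbIdeal.1 hp h

end

section

variable {n : ℕ} {Γ : Subgroup (GL (Fin n) ℂ)} {Λ : (Γ → ℂ) →ₗ[ℂ] ℂ}

/-- The differential of polynomials at a point, as a linear map to the dual space. -/
def differential (v : Fin n → ℂ) : MvPolynomial (Fin n) ℂ →ₗ[ℂ] Module.Dual ℂ (Fin n → ℂ) where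
  toFun p :=
    { toFun := dEval p v
      map_add' := fun x y => by simp [dEval, mul_add, Finset.sum_add_distrib]
      map_smul' := fun c x => by simp [dEval, Finset.mul_sum, mul_left_comm] }
  map_add' p q := LinearMap.ext fun w => dEval_add_left p q v w
  map_smul' c p := LinearMap.ext fun w => dEval_smul_left c p v w

theorem differential_apply (v w : Fin n → ℂ) (p : MvPolynomial (Fin n) ℂ) :
    differential v p w = dEval p v w := rfl

theorem dEval_act {p : MvPolynomial (Fin n) ℂ} (hp : ∀ (g : Γ) x, eval (act g x) p = eval x p)
    (g : Γ) (x w : Fin n → ℂ) : dEval p (act g x) (act g w) = dEval p x w := by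
  have : translate g.1.1 p = p := MvPolynomial.funext fun x => by
    rw [eval_translate_act, hp]
  conv_rhs => rw [← this, dEval_translate]
  rfl

/-- The average of an equivariantly translated polynomial vector field along an orbit. -/
def averageField (Λ : (Γ → ℂ) →ₗ[ℂ] ℂ) (v : Fin n → ℂ) (F : Fin n → MvPolynomial (Fin n) ℂ) :
    Fin n → ℂ :=
  fun i => Λ fun g => act g⁻¹ (fun k => eval (act g v) (F k)) i

theorem IsReynolds.act_averageField (hΛ : IsReynolds Γ Λ) {v : Fin n → ℂ}
    (F : Fin n → MvPolynomial (Fin n) ℂ) {h : Γ} (hv : act h v = v) :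
    act h (averageField Λ v F) = averageField Λ v F := by
  have hv' : act h⁻¹ v = v := by
    conv_lhs => rw [← hv, ← act_mul, inv_mul_cancel, act_one]
  have hreg : ∀ i, (fun g : Γ => act g⁻¹ (fun k => eval (act g v) (F k)) i) ∈ reg Γ := fun i => by
    have : (fun g : Γ => act g⁻¹ (fun k => eval (act g v) (F k)) i) =
        ∑ k, (fun g : Γ => (g⁻¹ : Γ).1.1 i k) * fun g : Γ => eval (act g v) (F k) := by
      ext g
      simp [act, Matrix.mulVec, dotProduct]
    rw [this]
    exact sum_mem fun k _ => mul_mem (inv_entry_mem_reg i k) (orb_mem_reg v (F k))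
  ext i
  have h1 : act h (averageField Λ v F) i =
      Λ fun g => act h (act g⁻¹ fun k => eval (act g v) (F k)) i := by
    have : (fun g : Γ => act h (act g⁻¹ fun k => eval (act g v) (F k)) i) =
        ∑ j, h.1.1 i j • fun g : Γ => act g⁻¹ (fun k => eval (act g v) (F k)) j := by
      ext g
      simp [act, Matrix.mulVec, dotProduct]
    rw [this, map_sum]
    simp only [map_smul, smul_eq_mul]
    rfl
  rw [h1, averageField, ← hΛ.right _ (hreg i) h⁻¹]
  congr 1
  ext g
  rw [← act_mul, mul_inv_rev, inv_inv, act_mul g, hv']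

theorem dEval_averageField {p : MvPolynomial (Fin n) ℂ}
    (hp : ∀ (g : Γ) x, eval (act g x) p = eval x p) (v : Fin n → ℂ)
    (F : Fin n → MvPolynomial (Fin n) ℂ) :
    dEval p v (averageField Λ v F) =
      Λ fun g => dEval p (act g v) fun k => eval (act g v) (F k) := by
  have : (fun g : Γ => dEval p (act g v) fun k => eval (act g v) (F k)) =
      ∑ i, eval v (pderiv i p) • fun g : Γ => act g⁻¹ (fun k => eval (act g v) (F k)) i := by
    ext g
    have h1 := dEval_act hp g v (act g⁻¹ fun k => eval (act g v) (F k))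
    rw [← act_mul, mul_inv_cancel, act_one] at h1
    rw [h1]
    simp [dEval]
  rw [this, map_sum]
  simp only [map_smul, smul_eq_mul]
  rfl

theorem exists_dual_vectors {ι V : Type*} [AddCommGroup V] [Module ℂ V] [FiniteDimensional ℂ V]
    [DecidableEq ι] {W : Submodule ℂ (Module.Dual ℂ V)} (b : Module.Basis ι ℂ W) :
    ∃ w : ι → V, ∀ i j, (b i).1 (w j) = if i = j then 1 else 0 := by
  choose φ hφ using fun j => LinearMap.exists_extend (b.coord j)
  refine ⟨fun j => (Module.evalEquiv ℂ V).symm (φ j), fun i j => ?_⟩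
  rw [Module.apply_evalEquiv_symm_apply]
  have := LinearMap.congr_fun (hφ j) (b i)
  simpa [Finsupp.single_apply] using this

theorem IsReynolds.exists_fixed_vector (hΛ : IsReynolds Γ Λ) {v : Fin n → ℂ}
    (hv : ClosedOrb Γ v) {S : Submodule ℂ (MvPolynomial (Fin n) ℂ)}
    (hS : ∀ p ∈ S, ∀ (g : Γ) x, eval (act g x) p = eval x p) (w : Fin n → ℂ) :
    ∃ w', (∀ h : Γ, act h v = v → act h w' = w') ∧ ∀ p ∈ S, dEval p v w' = dEval p v w := by
  classical
  let W := S.map (differential v)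
  let b := Module.finBasis ℂ W
  obtain ⟨u, hu⟩ := exists_dual_vectors b
  choose p hpS hp using fun i => (b i).2
  have hpb : ∀ i x, dEval (p i) v x = (b i).1 x := fun i x => LinearMap.congr_fun (hp i) x
  let M : Matrix _ _ (MvPolynomial (Fin n) ℂ) :=
    Matrix.of fun i j => ∑ k, pderiv k (p i) * C (u j k)
  have hM : ∀ x i j, eval x (M i j) = dEval (p i) x (u j) := fun x i j => by simp [M, dEval]
  let c : _ → MvPolynomial (Fin n) ℂ := fun i => C (dEval (p i) v w)
  have hdet : eval v M.det = 1 := by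
    have : (eval v).mapMatrix M = 1 := by
      ext i j
      rw [RingHom.mapMatrix_apply, Matrix.map_apply, hM, hpb, hu, Matrix.one_apply]
    rw [RingHom.map_det, this, Matrix.det_one]
  have hdet' : M.det ∉ orbIdeal Γ v := fun h => by
    have := mem_orbIdeal.1 h 1
    rw [act_one, hdet] at this
    exact one_ne_zero this
  obtain ⟨q, hq⟩ := hΛ.exists_eq_one hv hdet'
  let F : Fin n → MvPolynomial (Fin n) ℂ := fun k =>
    q * ∑ j, (M.adjugate.mulVec c) j * C (u j k)
  have hF : ∀ i x, dEval (p i) x (fun k => eval x (F k)) =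
      (eval x q * eval x M.det) * dEval (p i) v w := fun i x => by
    have h1 : M.mulVec (M.adjugate.mulVec c) i = M.det * c i := by
      rw [Matrix.mulVec_mulVec, Matrix.mul_adjugate, Matrix.smul_mulVec, Matrix.one_mulVec]
      rfl
    simp only [F]
    generalize M.adjugate.mulVec c = a at h1
    have h2 := congrArg (eval x) h1
    simp only [Matrix.mulVec, dotProduct, map_sum, map_mul, c, eval_C, hM] at h2
    rw [mul_assoc, ← h2]
    simp only [dEval, map_mul, map_sum, eval_C, Finset.mul_sum, Finset.sum_mul]
    rw [Finset.sum_comm]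
    exact Finset.sum_congr rfl fun j _ => Finset.sum_congr rfl fun k _ => by ring
  have hn : ∀ i, dEval (p i) v (averageField Λ v F) = dEval (p i) v w := fun i => by
    rw [dEval_averageField (hS _ (hpS i))]
    have : (fun g : Γ => dEval (p i) (act g v) fun k => eval (act g v) (F k)) =
        dEval (p i) v w • fun g : Γ => eval (act g v) q * eval (act g v) M.det := by
      ext g
      rw [hF]
      simp [mul_comm]
    rw [this, map_smul, hq, smul_eq_mul, mul_one]
  refine ⟨averageField Λ v F, fun h hh => hΛ.act_averageField F hh, fun p' hp' => ?_⟩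
  let W' : Submodule ℂ (Module.Dual ℂ (Fin n → ℂ)) :=
    LinearMap.ker (Module.Dual.eval ℂ (Fin n → ℂ) (averageField Λ v F - w))
  have hW : W ≤ W' := by
    have h1 : (⊤ : Submodule ℂ W) ≤ W'.comap W.subtype := by
      rw [← b.span_eq, Submodule.span_le]
      rintro _ ⟨i, rfl⟩
      change (b i).1 (averageField Λ v F - w) = 0
      rw [map_sub, ← hpb, ← hpb, hn, sub_self]
    exact fun x hx => h1 (x := ⟨x, hx⟩) trivial
  have : differential v p' (averageField Λ v F - w) = 0 := hW (Submodule.mem_map_of_mem hp')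
  rwa [map_sub, sub_eq_zero] at this

theorem IsReynolds.exists_fixed_complement (hΛ : IsReynolds Γ Λ) {v : Fin n → ℂ}
    (hv : ClosedOrb Γ v)
    (hred : orbIdeal Γ v ≤ Ideal.span {p : MvPolynomial (Fin n) ℂ |
      (∀ (g : Γ) x, eval (act g x) p = eval x p) ∧ p ∈ orbIdeal Γ v})
    {T : Submodule ℂ (Fin n → ℂ)} (hT : ∀ w, w ∈ T ↔ ∀ p ∈ orbIdeal Γ v, dEval p v w = 0) :
    ∃ N : Submodule ℂ (Fin n → ℂ), IsCompl T N ∧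
      ∀ h : Γ, act h v = v → ∀ x ∈ N, act h x = x := by
  let S : Submodule ℂ (MvPolynomial (Fin n) ℂ) :=
    { carrier := {p | (∀ (g : Γ) x, eval (act g x) p = eval x p) ∧ p ∈ orbIdeal Γ v}
      zero_mem' := ⟨fun g x => by simp, zero_mem _⟩
      add_mem' := fun {a b} ha hb => ⟨fun g x => by simp [ha.1 g x, hb.1 g x], add_mem ha.2 hb.2⟩
      smul_mem' := fun c a ha => ⟨fun g x => by simp [smul_eval, ha.1 g x],
        Submodule.smul_of_tower_mem _ c ha.2⟩ }
  have hTS : ∀ w, (∀ p ∈ S, dEval p v w = 0) → w ∈ T := fun w hw => by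
    rw [hT]
    intro p hp
    refine Submodule.span_induction (p := fun p _ => dEval p v w = 0) hw (by simp [dEval])
      (fun p q _ _ h1 h2 => by rw [dEval_add_left, h1, h2, add_zero])
      (fun a p h1 h2 => ?_) (hred hp)
    have h3 : eval v p = 0 := by
      refine Submodule.span_induction (p := fun p _ => eval v p = 0)
        (fun p hp => ?_) (map_zero _) (fun p q _ _ h1 h2 => by rw [map_add, h1, h2, add_zero])
        (fun a p _ h => by rw [smul_eq_mul, map_mul, h, mul_zero]) h1
      simpa using mem_orbIdeal.1 hp.2 1
    rw [smul_eq_mul, dEval_mul_left, h2, h3, mul_zero, zero_mul, add_zero]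
  let U : Submodule ℂ (Fin n → ℂ) :=
    { carrier := {w | ∀ h : Γ, act h v = v → act h w = w}
      zero_mem' := fun h _ => by simp [act]
      add_mem' := fun {a b} ha hb h hh => by
        have h1 : act h (a + b) = act h a + act h b := Matrix.mulVec_add _ _ _
        rw [h1, ha h hh, hb h hh]
      smul_mem' := fun c a ha h hh => by
        have h1 : act h (c • a) = c • act h a := Matrix.mulVec_smul _ _ _
        rw [h1, ha h hh] }
  have hTU : Codisjoint T U := by
    rw [codisjoint_iff, eq_top_iff]
    intro w _
    obtain ⟨w', h1, h2⟩ := hΛ.exists_fixed_vector hv (S := S) (fun p hp => hp.1) w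
    rw [← sub_add_cancel w w']
    refine Submodule.add_mem_sup (hTS _ fun p hp => ?_) h1
    rw [← differential_apply, map_sub, differential_apply, differential_apply, h2 p hp, sub_self]
  obtain ⟨N, hN, hc⟩ := hTU.symm.exists_isCompl
  exact ⟨N, hc.symm, fun h hh x hx => hN hx h hh⟩

end

section

variable {n : ℕ} {G : Set (Matrix (Fin n) (Fin n) ℂ)}

theorem invariant_iff (hG : IsMatSubgroup ℂ n G) {p : MvPolynomial (Fin n) ℂ} :
    Invariant ℂ n G p ↔ ∀ (g : glSubgroup G hG) x, eval (act g x) p = eval x p := by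
  refine ⟨fun h g x => h _ g.2 x, fun h g hg x => ?_⟩
  obtain ⟨g, rfl⟩ := exists_mem_glSubgroup hG hg
  exact h g x

theorem orbit_eq_range (hG : IsMatSubgroup ℂ n G) (v : Fin n → ℂ) :
    orbit ℂ n G v = Set.range fun g : glSubgroup G hG => act g v := by
  ext x
  constructor
  · rintro ⟨g, hg, rfl⟩
    obtain ⟨g, rfl⟩ := exists_mem_glSubgroup hG hg
    exact ⟨g, rfl⟩
  · rintro ⟨g, rfl⟩
    exact ⟨_, g.2, rfl⟩

theorem HasClosedOrbit.closedOrb (hG : IsMatSubgroup ℂ n G) {v : Fin n → ℂ}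
    (hv : HasClosedOrbit ℂ n G v) : ClosedOrb (glSubgroup G hG) v := fun x hx => by
  rw [HasClosedOrbit, orbit_eq_range hG] at hv
  exact hv hx

theorem HasClosedOrbit.isAlgebraicSet {v : Fin n → ℂ} (hv : HasClosedOrbit ℂ n G v) :
    IsAlgebraicSet ℂ n (orbit ℂ n G v) :=
  ⟨_, Set.Subset.antisymm (fun x hx p (hp : ∀ y ∈ orbit ℂ n G v, eval y p = 0) => hp x hx) hv⟩

theorem IsPrincipalPt.eq_zero_of_forall_eval (hG : IsMatSubgroup ℂ n G)
    (hz : IsZClosedInGL ℂ n G) {v : Fin n → ℂ} (hv : IsPrincipalPt ℂ n G v)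
    {p : MvPolynomial (Fin n) ℂ}
    (hp : ∀ x, (∀ h : glSubgroup G hG, act h v = v → act h x = x) →
      ∀ g : glSubgroup G hG, eval (act g x) p = 0) : p = 0 := by
  obtain ⟨-, N, hN, ht⟩ := hv
  refine eq_zero_of_forall_eval_slice hG hz hN.1.codisjoint fun g hg ν hν => ?_
  obtain ⟨g, rfl⟩ := exists_mem_glSubgroup hG hg
  refine hp (v + ν) (fun h hh => ?_) g
  have h1 : act h (v + ν) = act h v + act h ν := Matrix.mulVec_add _ _ _
  have h2 : act h ν = ν := ht h.1.1 ⟨h.2, hh⟩ ν hν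
  rw [h1, h2, hh]

theorem isGReduced_of_forall_exists (hG : IsReductiveGroup ℂ n G) {Y : Set (Fin n → ℂ)}
    (hYa : IsAlgebraicSet ℂ n Y) (hYs : Stabilizes ℂ n G Y)
    (hY : ∀ y ∈ Y, ∃ g ∈ G, IsPrincipalPt ℂ n G (g.mulVec y)) : IsGReduced ℂ n G Y := by
  obtain ⟨Λ, hΛ⟩ := hG.exists_isReynolds
  refine le_antisymm (Ideal.span_le.2 fun p hp => hp.2) fun f hf => ?_
  have := mem_span_invariants hΛ (isAffineGroup_glSubgroup hG.1 hG.2.1) hYa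
    (fun g y hy => hYs _ g.2 y hy) (fun y hy => ?_) hf
  · simpa only [invariantIdeal, invariant_iff hG.1] using this
  · obtain ⟨g, hg, h1⟩ := hY y hy
    obtain ⟨g, rfl⟩ := exists_mem_glSubgroup hG.1 hg
    exact ⟨g, h1.1.closedOrb hG.1, fun p hp => h1.eq_zero_of_forall_eval hG.1 hG.2.1 hp⟩

theorem stabilizes_orbit (hG : IsMatSubgroup ℂ n G) (v : Fin n → ℂ) :
    Stabilizes ℂ n G (orbit ℂ n G v) := by
  rintro g hg _ ⟨h, hh, rfl⟩
  exact ⟨g * h, hG.2.1 g hg h hh, (Matrix.mulVec_mulVec v g h).symm⟩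

theorem IsPrincipalPt.isGReduced_orbit (hG : IsReductiveGroup ℂ n G) {v : Fin n → ℂ}
    (hv : IsPrincipalPt ℂ n G v) : IsGReduced ℂ n G (orbit ℂ n G v) := by
  refine isGReduced_of_forall_exists hG hv.1.isAlgebraicSet (stabilizes_orbit hG.1 v) ?_
  rintro _ ⟨g, hg, rfl⟩
  obtain ⟨g, rfl⟩ := exists_mem_glSubgroup hG.1 hg
  refine ⟨_, g⁻¹.2, ?_⟩
  have h1 : act g⁻¹ (act g v) = v := by rw [← act_mul, inv_mul_cancel, act_one]
  change IsPrincipalPt ℂ n G (act g⁻¹ (act g v))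
  rwa [h1]

theorem isPrincipalPt_of_isGReduced_orbit (hG : IsReductiveGroup ℂ n G) {v : Fin n → ℂ}
    (hv : HasClosedOrbit ℂ n G v) (h : IsGReduced ℂ n G (orbit ℂ n G v)) :
    IsPrincipalPt ℂ n G v := by
  obtain ⟨Λ, hΛ⟩ := hG.exists_isReynolds
  have hI : orbIdeal (glSubgroup G hG.1) v = vanishingIdeal ℂ n (orbit ℂ n G v) := by
    rw [orbit_eq_range hG.1]
    rfl
  obtain ⟨N, hN, hf⟩ := hΛ.exists_fixed_complement (hv.closedOrb hG.1) (v := v)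
    (T := orbitTangent ℂ n G v) (by
      rw [hI, ← h, invariantIdeal]
      refine Ideal.span_mono fun p hp => ⟨(invariant_iff hG.1).1 hp.1, ?_⟩
      exact Ideal.subset_span hp)
    fun w => ⟨fun hw p hp => dEval_eq_zero_of_mem_orbitTangent hG.1 hG.2.1 hw hp,
      mem_orbitTangent hG.1 hG.2.1⟩
  have ht : ActsTriviallyOn ℂ n (isotropy ℂ n G v) N := by
    rintro g ⟨hg, hgv⟩ x hx
    obtain ⟨g, rfl⟩ := exists_mem_glSubgroup hG.1 hg
    exact hf g hgv x hx
  exact ⟨hv, N, ⟨hN, fun g hg x hx => by rwa [ht g hg x hx]⟩, ht⟩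

end

/-- **Proposition 3.1(2).** Let `G` be a complex reductive group and `V = ℂⁿ` a stable
`G`-module.  If a `G`-stable algebraic subset `Y ⊆ V` satisfies `Y = Y_pr`, then `Y` is
`G`-reduced.  In particular a closed orbit `Gv` is `G`-reduced if and only if it is
principal. -/
theorem G_reduced_of_all_pr
    (n : ℕ) (G : Set (Matrix (Fin n) (Fin n) ℂ)) (hG : IsReductiveGroup ℂ n G)
    (hstab : IsStableModule ℂ n G) :
    (∀ Y : Set (Fin n → ℂ), IsAlgebraicSet ℂ n Y → Stabilizes ℂ n G Y →
      Y ⊆ prPoints ℂ n G → IsGReduced ℂ n G Y) ∧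
    (∀ v : Fin n → ℂ, HasClosedOrbit ℂ n G v →
      (IsGReduced ℂ n G (orbit ℂ n G v) ↔ IsPrincipalPt ℂ n G v)) := by
  refine ⟨fun Y hYa hYs hY => isGReduced_of_forall_exists hG hYa hYs fun y hy =>
    ⟨1, hG.1.1, ?_⟩, fun v hv => ⟨isPrincipalPt_of_isGReduced_orbit hG hv,
    IsPrincipalPt.isGReduced_orbit hG⟩⟩
  rw [Matrix.one_mulVec]
  exact hY hy

end ZPaper
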